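/- arXiv:1405.4627 — 5 statements merged into one kernel-verified Lean document; each statement's English description precedes it below -/
import Mathlib

section
/- Let A and B be Noetherian local rings with maximal ideals m_A and m_B respectively, and let φ: A → B be a faithfully flat ring homomorphism such that the radical of m_A·B equals m_B. Let M be an A-module of finite length. Then M ⊗_A B is a B-module of finite length and ℓ_B(M ⊗_A B) = ℓ_A(M) · ℓ_B(B/m_A B), where ℓ denotes length. -/
universe u v

open TensorProduct

/-- The length of an `R`-module `M`, as the supremum in `ℕ∞` of the lengths of strictly
increasing chains of submodules of `M`. -/
noncomputable def moduleLength (R : Type u) (M : Type v) [Ring R] [AddCommGroup M]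
    [Module R M] : ℕ∞ :=
  ⨆ p : LTSeries (Submodule R M), (p.length : ℕ∞)

/-- The supremum of lengths of chains of submodules agrees with `Module.length`. -/
theorem moduleLength_eq_length (R : Type u) (M : Type v) [Ring R] [AddCommGroup M]
    [Module R M] : moduleLength R M = Module.length R M := by
  apply WithBot.coe_injective
  rw [Module.coe_length, Order.krullDim_eq_iSup_length, moduleLength]

/-- In a Noetherian local ring, the quotient by an ideal whose radical is the maximal ideal has
finite length. -/
theorem isFiniteLength_quotient_of_radical_eq_maximalIdeal {R : Type*} [CommRing R]
    [IsNoetherianRing R] [IsLocalRing R] {I : Ideal R}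
    (hI : I.radical = IsLocalRing.maximalIdeal R) : IsFiniteLength R (R ⧸ I) := by
  have : Ring.KrullDimLE 0 (R ⧸ I) := by
    refine Ideal.krullDimLE_zero_quotient_iff_forall_minimalPrimes_isMaximal.mpr fun J hJ ↦ ?_
    have hle : IsLocalRing.maximalIdeal R ≤ J := hI ▸ hJ.1.1.radical_le_iff.mpr hJ.1.2
    rw [← (IsLocalRing.maximalIdeal.isMaximal R).eq_of_le hJ.1.1.ne_top hle]
    infer_instance
  have : IsArtinianRing (R ⧸ I) := isArtinianRing_iff_krullDimLE_zero.mpr this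
  rw [← Module.length_ne_top_iff, Module.length_eq_of_surjective (S := R) (R := R ⧸ I)
    Ideal.Quotient.mk_surjective]
  exact Module.length_ne_top

/-- Lemma 2.2: if `A`, `B` are Noetherian local rings, `A → B` is faithfully flat with
`√(m_A·B) = m_B`, and `M` is an `A`-module of finite length, then `M ⊗_A B` has finite length
as a `B`-module and `ℓ_B(M ⊗_A B) = ℓ_A(M) · ℓ_B(B/m_A B)`. -/
theorem length_tensor_eq_length_mul_length {A B : Type u} [CommRing A] [CommRing B]
    [IsNoetherianRing A] [IsNoetherianRing B] [IsLocalRing A] [IsLocalRing B]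
    [Algebra A B] [Module.FaithfullyFlat A B]
    (hrad : ((IsLocalRing.maximalIdeal A).map (algebraMap A B)).radical =
      IsLocalRing.maximalIdeal B)
    (M : Type u) [AddCommGroup M] [Module A M] (hM : IsFiniteLength A M) :
    IsFiniteLength B (B ⊗[A] M) ∧
      moduleLength B (B ⊗[A] M) =
        moduleLength A M *
          moduleLength B (B ⧸ (IsLocalRing.maximalIdeal A).map (algebraMap A B)) := by
  have : IsLocalHom (algebraMap A B) :=
    ((IsLocalRing.local_hom_TFAE (algebraMap A B)).out 0 2).mpr (hrad ▸ Ideal.le_radical)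
  have hlen := IsLocalRing.length_baseChange A B M
  refine ⟨?_, by simpa only [moduleLength_eq_length] using hlen⟩
  rw [← Module.length_ne_top_iff, hlen]
  exact WithTop.mul_ne_top (Module.length_ne_top_iff.mpr hM)
    (Module.length_ne_top_iff.mpr (isFiniteLength_quotient_of_radical_eq_maximalIdeal hrad))
end

section
/- Let φ: A → B be a flat homomorphism of Noetherian commutative rings, where B has a unique maximal ideal (B is local). Then φ is Weierstrass if and only if every prime ideal P of B satisfies both: (a) P = φ(φ⁻¹(P))·B, i.e. P is generated by elements in the image of φ; and (b) either the localization B_P is a principal ideal ring, or the canonical inclusion of residue fields k_A(φ⁻¹(P)) → k_B(P) is an isomorphism. -/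
/-- A ring homomorphism `φ : A → B` between commutative rings is *Weierstrass* if every `b ∈ B`
factors as `b = φ(a) * b'` with `a ∈ A` and `b'` a unit of `B`. -/
def RingHom.IsWeierstrass {A B : Type*} [CommRing A] [CommRing B] (φ : A →+* B) : Prop :=
  ∀ b : B, ∃ (a : A) (b' : Bˣ), b = φ a * b'

/-- A ring homomorphism `φ : A → B` is flat if `B` is flat as an `A`-module via `φ`. -/
def RingHom.IsFlat {A B : Type*} [CommRing A] [CommRing B] (φ : A →+* B) : Prop :=
  letI := φ.toAlgebra
  Module.Flat A B

/-- For a prime `P` of `B` and `φ : A → B`, the canonical inclusion of residue fields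
`k_A(φ⁻¹(P)) → k_B(P)`. -/
noncomputable def residueFieldInclusion {A B : Type*} [CommRing A] [CommRing B]
    (φ : A →+* B) (P : Ideal B) [P.IsPrime] :
    IsLocalRing.ResidueField (Localization.AtPrime (P.comap φ)) →+*
      IsLocalRing.ResidueField (Localization.AtPrime P) :=
  letI := Localization.isLocalHom_localRingHom (P.comap φ) P φ rfl
  IsLocalRing.ResidueField.map (Localization.localRingHom (P.comap φ) P φ rfl)

section WeierstrassAux

variable {A B : Type*} [CommRing A] [CommRing B]

/-- Every element of an extended ideal is a finite combination of images of elements. -/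
theorem Ideal.exists_sum_of_mem_map [Algebra A B] {𝔞 : Ideal A} {y : B}
    (hy : y ∈ 𝔞.map (algebraMap A B)) :
    ∃ (n : ℕ) (b : Fin n → B) (a : Fin n → A), (∀ i, a i ∈ 𝔞) ∧ ∑ i, a i • b i = y := by
  obtain ⟨n, b, g, rfl⟩ := Submodule.mem_span_set'.mp hy
  choose a ha hag using fun i => (g i).2
  exact ⟨n, b, a, ha, Finset.sum_congr rfl fun i _ => by
    rw [Algebra.smul_def, hag, smul_eq_mul, mul_comm]⟩

/-- Extension along a flat homomorphism commutes with `𝔠 ⊓ (𝔞 : f)`. -/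
theorem Ideal.mem_map_inf_colon_of_flat [Algebra A B] [Module.Flat A B] {𝔞 𝔠 : Ideal A} {f : A}
    {y : B} (hy : y ∈ 𝔠.map (algebraMap A B))
    (hfy : algebraMap A B f * y ∈ 𝔞.map (algebraMap A B)) :
    y ∈ (𝔠 ⊓ Submodule.colon 𝔞 {f}).map (algebraMap A B) := by
  obtain ⟨n, b, c, hc, rfl⟩ := exists_sum_of_mem_map hy
  obtain ⟨m, d, a, ha, had⟩ := exists_sum_of_mem_map hfy
  have hrel : ∑ i : Fin n ⊕ Fin m, Sum.elim (fun i => f * c i) (fun j => - a j) i •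
      Sum.elim b d i = 0 := by
    simp only [Fintype.sum_sum_type, Sum.elim_inl, Sum.elim_inr, mul_smul, neg_smul,
      ← Finset.smul_sum, Finset.sum_neg_distrib, had]
    rw [Algebra.smul_def, add_neg_cancel]
  obtain ⟨k, e, z, hez, hz⟩ :=
    Module.Flat.isTrivialRelation_of_sum_smul_eq_zero (R := A) (M := B) hrel
  have hsum : ∑ i, c i • b i = ∑ j, (∑ i, c i * e (Sum.inl i) j) • z j := by
    simp only [Finset.sum_smul, mul_smul]
    rw [Finset.sum_comm]
    refine Finset.sum_congr rfl fun i _ => ?_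
    rw [← Finset.smul_sum]
    congr 1
    simpa using hez (Sum.inl i)
  rw [hsum]
  refine Ideal.sum_mem _ fun j _ => ?_
  rw [Algebra.smul_def]
  refine Ideal.mul_mem_right _ _ (Ideal.mem_map_of_mem _ ⟨?_, ?_⟩)
  · exact Ideal.sum_mem _ fun i _ => Ideal.mul_mem_right _ _ (hc i)
  · have h := hz j
    simp only [Fintype.sum_sum_type, Sum.elim_inl, Sum.elim_inr] at h
    rw [SetLike.mem_coe, Submodule.mem_colon_singleton, smul_eq_mul, mul_comm, Finset.mul_sum]
    simp only [← mul_assoc]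
    rw [eq_neg_of_add_eq_zero_left h]
    exact neg_mem (Ideal.sum_mem _ fun i _ => Ideal.mul_mem_right _ _ (neg_mem (ha i)))

/-- Extension along a flat homomorphism commutes with colons by finitely generated ideals. -/
theorem Ideal.mem_map_colon_of_flat [Algebra A B] [Module.Flat A B] {𝔞 𝔭 : Ideal A}
    (h𝔭 : 𝔭.FG) {y : B}
    (hy : ∀ f ∈ 𝔭, algebraMap A B f * y ∈ 𝔞.map (algebraMap A B)) :
    y ∈ (Submodule.colon 𝔞 (𝔭 : Set A)).map (algebraMap A B) := by
  obtain ⟨s, rfl⟩ := h𝔭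
  have hs : ∀ t : Finset A, t ⊆ s →
      y ∈ (Submodule.colon 𝔞 (t : Set A)).map (algebraMap A B) := by
    classical
    intro t
    induction t using Finset.induction_on with
    | empty => intro _; simp [Ideal.map_top]
    | insert f t _ ih =>
      intro hts
      have h := mem_map_inf_colon_of_flat (ih ((Finset.subset_insert f t).trans hts))
        (hy f (Ideal.subset_span (hts (Finset.mem_insert_self f t))))
      refine Ideal.map_mono (fun x hx => ?_) h
      rw [Submodule.mem_colon]
      intro g hg
      rcases Finset.mem_insert.mp (Finset.mem_coe.mp hg) with rfl | hg
      · exact Submodule.mem_colon_singleton.mp hx.2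
      · exact Submodule.mem_colon.mp hx.1 g hg
  refine Ideal.map_mono (fun x hx => ?_) (hs s subset_rfl)
  rw [Submodule.mem_colon] at hx ⊢
  intro g hg
  have : Ideal.span (s : Set A) ≤ Submodule.colon 𝔞 {x} := Ideal.span_le.mpr fun g hg => by
    rw [SetLike.mem_coe, Submodule.mem_colon_singleton, smul_eq_mul, mul_comm]
    exact hx g hg
  have := Submodule.mem_colon_singleton.mp (this hg)
  rwa [smul_eq_mul, mul_comm] at this

/-- In a local ring, if `(x, y)` is principal then `x ∣ y` or `y ∣ x`. -/
theorem IsLocalRing.dvd_or_dvd_of_isPrincipal_span_pair {R : Type*} [CommRing R] [IsLocalRing R]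
    {x y : R} (h : (Ideal.span {x, y}).IsPrincipal) : x ∣ y ∨ y ∣ x := by
  obtain ⟨g, hg⟩ := h
  rw [Ideal.submodule_span_eq] at hg
  obtain ⟨x', hx⟩ := Ideal.mem_span_singleton.mp
    (hg ▸ Ideal.subset_span (by simp) : x ∈ Ideal.span {g})
  obtain ⟨y', hy⟩ := Ideal.mem_span_singleton.mp
    (hg ▸ Ideal.subset_span (by simp) : y ∈ Ideal.span {g})
  obtain ⟨α, β, hαβ⟩ := Ideal.mem_span_pair.mp
    (hg ▸ Ideal.mem_span_singleton_self g : g ∈ Ideal.span {x, y})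
  rcases IsLocalRing.isUnit_or_isUnit_of_add_one
    (a := α * x' + β * y') (b := 1 - (α * x' + β * y')) (by ring) with hu | hu
  · rcases IsLocalRing.isUnit_or_isUnit_of_isUnit_add hu with hu | hu
    · left
      rw [hx, hy, (isUnit_of_mul_isUnit_right hu).mul_right_dvd]
      exact dvd_mul_right g y'
    · right
      rw [hx, hy, (isUnit_of_mul_isUnit_right hu).mul_right_dvd]
      exact dvd_mul_right g x'
  · have hg0 : g = 0 := hu.mul_left_eq_zero.mp (by
      linear_combination hαβ * (-1) + α * hx + β * hy)
    left
    simp [hx, hy, hg0]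

/-- In a Noetherian ring, an ideal not contained in `J` has an element whose annihilator
modulo `J` is prime. -/
theorem Ideal.exists_isPrime_colon_of_not_le [IsNoetherianRing B] {I J : Ideal B}
    (h : ¬ I ≤ J) : ∃ y ∈ I, (Submodule.colon J {y}).IsPrime := by
  have : Nontrivial (Submodule.map J.mkQ I) := by
    obtain ⟨x, hx, hxJ⟩ := SetLike.not_le_iff_exists.mp h
    refine ⟨⟨⟨J.mkQ x, Submodule.mem_map_of_mem hx⟩, 0, fun h0 => hxJ ?_⟩⟩
    exact (Submodule.Quotient.mk_eq_zero J).mp (congrArg Subtype.val h0)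
  obtain ⟨P, hP⟩ := associatedPrimes.nonempty B (Submodule.map J.mkQ I)
  obtain ⟨hprime, ⟨_, y, hy, rfl⟩, hPy⟩ := isAssociatedPrime_iff.mp hP
  refine ⟨y, hy, ?_⟩
  convert hprime
  rw [hPy]
  ext b
  rw [Submodule.mem_colon_singleton, Submodule.mem_colon_singleton, Submodule.mem_bot,
    Subtype.ext_iff]
  exact (Submodule.Quotient.mk_eq_zero J (x := b • y)).symm

/-- If every prime of `B` is extended, an ideal not contained in a prime `P` contains the image
of an element mapping outside `P`. -/
theorem Ideal.exists_map_mem_of_not_le (φ : A →+* B)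
    (h : ∀ (P : Ideal B) [P.IsPrime], P = (P.comap φ).map φ) {K P : Ideal B} [P.IsPrime]
    (hKP : ¬ K ≤ P) : ∃ c, φ c ∈ K ∧ φ c ∉ P := by
  by_contra! hc
  have hdisj : Disjoint (K : Set B) ((P.comap φ).primeCompl.map φ) := by
    rw [Set.disjoint_left]
    rintro _ hx ⟨c, hcP, rfl⟩
    exact hcP (hc c hx)
  obtain ⟨Q, hQ, hKQ, hQd⟩ := Ideal.exists_le_prime_disjoint K _ hdisj
  refine hKP (hKQ.trans ?_)
  rw [h Q, Ideal.map_le_iff_le_comap]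
  intro c hcQ
  by_contra hcP
  exact Set.disjoint_left.mp hQd hcQ ⟨c, hcP, rfl⟩

/-- If the residue field inclusion is surjective, every element of `B` is a fraction of elements
of `A` modulo `P`. -/
theorem exists_mul_sub_mem_of_residueFieldInclusion_surjective (φ : A →+* B) (P : Ideal B)
    [P.IsPrime] (h : Function.Surjective (residueFieldInclusion φ P)) (b : B) :
    ∃ β α, φ β ∉ P ∧ φ β * b - φ α ∈ P := by
  obtain ⟨x, hx⟩ := h (IsLocalRing.residue _ (algebraMap B (Localization.AtPrime P) b))
  obtain ⟨x, rfl⟩ := IsLocalRing.residue_surjective x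
  obtain ⟨⟨α, β⟩, rfl⟩ := IsLocalization.mk'_surjective (P.comap φ).primeCompl x
  refine ⟨β, α, β.2, ?_⟩
  have := Localization.isLocalHom_localRingHom (P.comap φ) P φ rfl
  have key : IsLocalRing.residue (Localization.AtPrime P)
      (algebraMap B _ (φ β * b - φ α)) = 0 := by
    rw [map_sub, map_mul, map_sub, map_mul, ← hx, residueFieldInclusion,
      IsLocalRing.ResidueField.map_residue, ← map_mul,
      ← Localization.localRingHom_to_map (P.comap φ) P φ rfl, ← map_mul, mul_comm,
      IsLocalization.mk'_spec, Localization.localRingHom_to_map, sub_self]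
  rw [IsLocalRing.residue_eq_zero_iff] at key
  exact (IsLocalization.AtPrime.to_map_mem_maximal_iff _ P _).mp key

/-- If `B_P` is a principal ideal ring, then two elements of `B` divide one another up to a factor
outside `P`. -/
theorem exists_mul_eq_mul_of_isPrincipalIdealRing (P : Ideal B) [P.IsPrime]
    [IsPrincipalIdealRing (Localization.AtPrime P)] (x y : B) :
    ∃ s t, s * x = t * y ∧ (s ∉ P ∨ t ∉ P) := by
  have key : ∀ x y : B, algebraMap B (Localization.AtPrime P) x ∣ algebraMap B _ y →
      ∃ s t, s * y = t * x ∧ s ∉ P := by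
    rintro x y ⟨z, hz⟩
    obtain ⟨⟨b, s⟩, rfl⟩ := IsLocalization.mk'_surjective P.primeCompl z
    have : algebraMap B (Localization.AtPrime P) (s * y) = algebraMap B _ (b * x) := by
      rw [map_mul, hz, mul_left_comm, IsLocalization.mk'_spec', map_mul, mul_comm]
    obtain ⟨c, hc⟩ := (IsLocalization.eq_iff_exists P.primeCompl _).mp this
    exact ⟨c * s, c * b, by linear_combination hc, (c * s).2⟩
  rcases IsLocalRing.dvd_or_dvd_of_isPrincipal_span_pair
    (IsPrincipalIdealRing.principal (Ideal.span {algebraMap B (Localization.AtPrime P) x,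
      algebraMap B (Localization.AtPrime P) y})) with h | h
  · obtain ⟨s, t, hst, hs⟩ := key x y h
    exact ⟨t, s, hst.symm, Or.inr hs⟩
  · obtain ⟨s, t, hst, hs⟩ := key y x h
    exact ⟨s, t, hst, Or.inl hs⟩

/-- Under the conditions on primes, every ideal of a flat Noetherian extension is extended. -/
theorem Ideal.le_map_comap_of_forall_isPrime [Algebra A B] [Module.Flat A B] [IsNoetherianRing A]
    [IsNoetherianRing B]
    (h : ∀ (P : Ideal B) [P.IsPrime], P = (P.comap (algebraMap A B)).map (algebraMap A B) ∧
      (IsPrincipalIdealRing (Localization.AtPrime P) ∨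
        Function.Bijective (residueFieldInclusion (algebraMap A B) P)))
    (I : Ideal B) : I ≤ (I.comap (algebraMap A B)).map (algebraMap A B) := by
  by_contra hI
  obtain ⟨y, hyI, hP⟩ := exists_isPrime_colon_of_not_le hI
  set φ := algebraMap A B
  set 𝔞 := I.comap φ
  set J := 𝔞.map φ
  have hJI : J ≤ I := Ideal.map_comap_le
  set P := Submodule.colon J {y}
  have memP : ∀ b, b ∈ P ↔ b * y ∈ J := fun b => Submodule.mem_colon_singleton
  set M := Submodule.colon 𝔞 (P.comap φ : Set A)
  have hyM : y ∈ M.map φ := mem_map_colon_of_flat (IsNoetherian.noetherian _)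
    fun f hf => (memP _).mp hf
  have hPM : ∀ m ∈ M, ∀ b ∈ P, b * φ m ∈ J := by
    intro m hm
    have : P ≤ Submodule.colon J {φ m} := by
      rw [(h P).1, Ideal.map_le_iff_le_comap]
      intro c hc
      rw [Ideal.mem_comap, Submodule.mem_colon_singleton, smul_eq_mul, ← map_mul, mul_comm]
      exact Ideal.mem_map_of_mem φ (Submodule.mem_colon.mp hm c hc)
    exact fun b hb => Submodule.mem_colon_singleton.mp (this hb)
  have hmJ : ∀ m, φ m ∈ I → φ m ∈ J := fun m hm => Ideal.mem_map_of_mem φ hm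
  rcases (h P).2 with hpir | hbij
  · obtain ⟨m, hm, hmP⟩ : ∃ m ∈ M, ∀ s, s * φ m ∈ J → s ∈ P := by
      by_contra! hcon
      have : ∃ s, s * y ∈ J ∧ s ∉ P := by
        refine Submodule.span_induction (p := fun z _ => ∃ s, s * z ∈ J ∧ s ∉ P) ?_ ?_ ?_ ?_ hyM
        · rintro _ ⟨m, hm, rfl⟩
          exact hcon m hm
        · exact ⟨1, by simp, hP.one_notMem⟩
        · rintro x z _ _ ⟨s, hs, hsP⟩ ⟨t, ht, htP⟩
          refine ⟨s * t, ?_, fun hst => (hP.mem_or_mem hst).elim hsP htP⟩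
          rw [show s * t * (x + z) = t * (s * x) + s * (t * z) by ring]
          exact add_mem (J.mul_mem_left _ hs) (J.mul_mem_left _ ht)
        · rintro b x _ ⟨s, hs, hsP⟩
          refine ⟨s, ?_, hsP⟩
          rw [smul_eq_mul, mul_left_comm]
          exact J.mul_mem_left _ hs
      obtain ⟨s, hs, hsP⟩ := this
      exact hsP ((memP s).mpr hs)
    obtain ⟨s, t, hst, hor⟩ := exists_mul_eq_mul_of_isPrincipalIdealRing P y (φ m)
    have hiff : s ∈ P ↔ t ∈ P := by
      rw [memP, hst]
      exact ⟨hmP t, hPM m hm t⟩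
    have hsP : s ∉ P := by tauto
    have htP : t ∉ P := by tauto
    have hK : ¬ Submodule.colon I {φ m} ≤ P := fun hle => htP (hle (by
      rw [Submodule.mem_colon_singleton, smul_eq_mul, ← hst]
      exact I.mul_mem_left _ hyI))
    obtain ⟨c, hcI, hcP⟩ := exists_map_mem_of_not_le φ (fun Q _ => (h Q).1) hK
    rw [Submodule.mem_colon_singleton, smul_eq_mul, ← map_mul] at hcI
    have := hmJ _ hcI
    rw [map_mul] at this
    exact hcP (hmP _ this)
  · obtain ⟨β, m, hβ, hβm⟩ : ∃ β m, φ β ∉ P ∧ m ∈ M ∧ φ β * y - φ m ∈ J := by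
      refine Submodule.span_induction
        (p := fun z _ => ∃ β m, φ β ∉ P ∧ m ∈ M ∧ φ β * z - φ m ∈ J) ?_ ?_ ?_ ?_ hyM
      · rintro _ ⟨m, hm, rfl⟩
        exact ⟨1, m, by simpa using hP.one_notMem, hm, by simp⟩
      · exact ⟨1, 0, by simpa using hP.one_notMem, zero_mem _, by simp⟩
      · rintro x z _ _ ⟨β, m, hβ, hm, hx⟩ ⟨γ, n, hγ, hn, hz⟩
        refine ⟨β * γ, γ * m + β * n, ?_, add_mem (M.mul_mem_left _ hm) (M.mul_mem_left _ hn), ?_⟩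
        · rw [map_mul]
          exact fun hst => (hP.mem_or_mem hst).elim hβ hγ
        · have := add_mem (J.mul_mem_left (φ γ) hx) (J.mul_mem_left (φ β) hz)
          convert this using 1
          simp only [map_add, map_mul]
          ring
      · rintro b x _ ⟨β, m, hβ, hm, hx⟩
        obtain ⟨γ, α, hγ, hα⟩ :=
          exists_mul_sub_mem_of_residueFieldInclusion_surjective φ P hbij.2 b
        refine ⟨γ * β, α * m, ?_, M.mul_mem_left _ hm, ?_⟩
        · rw [map_mul]
          exact fun hst => (hP.mem_or_mem hst).elim hγ hβ
        · have := add_mem (J.mul_mem_left (φ γ * b) hx) (hPM m hm _ hα)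
          convert this using 1
          simp only [smul_eq_mul, map_mul]
          ring
    have hmI : φ m ∈ I := by
      have := sub_mem (I.mul_mem_left (φ β) hyI) (hJI hβm.2)
      rwa [sub_sub_cancel] at this
    refine hβ ((memP _).mpr ?_)
    have := add_mem hβm.2 (hmJ m hmI)
    rwa [sub_add_cancel] at this

/-- If every ideal of the local ring `B` is extended along `φ`, then `φ` is Weierstrass. -/
theorem RingHom.isWeierstrass_of_forall_le_map_comap [IsLocalRing B] (φ : A →+* B)
    (h : ∀ I : Ideal B, I ≤ (I.comap φ).map φ) : φ.IsWeierstrass := by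
  intro b
  by_contra! hb
  have hb0 : b ≠ 0 := fun h0 => hb 0 1 (by simp [h0])
  have hle : ((Ideal.span {b}).comap φ).map φ ≤ IsLocalRing.maximalIdeal B * Ideal.span {b} := by
    rw [Ideal.map_le_iff_le_comap]
    intro a ha
    obtain ⟨c, hc⟩ := Ideal.mem_span_singleton'.mp ha
    rw [Ideal.mem_comap, ← hc]
    refine Ideal.mul_mem_mul ?_ (Ideal.mem_span_singleton_self b)
    rw [IsLocalRing.mem_maximalIdeal, mem_nonunits_iff]
    rintro ⟨u, rfl⟩
    exact hb a u⁻¹ (by rw [← hc, mul_right_comm, Units.mul_inv, one_mul])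
  obtain ⟨c, hc, hcb⟩ := Ideal.mem_mul_span_singleton.mp
    (hle (h _ (Ideal.mem_span_singleton_self b)))
  have hu : IsUnit (1 - c) := by
    rcases IsLocalRing.isUnit_or_isUnit_one_sub_self c with hu | hu
    · exact absurd hu hc
    · exact hu
  exact hb0 (hu.mul_right_eq_zero.mp (by linear_combination -hcb))

/-- The map induced by a Weierstrass homomorphism on localizations at primes is Weierstrass. -/
theorem RingHom.IsWeierstrass.localRingHom {φ : A →+* B} (h : φ.IsWeierstrass) (P : Ideal B)
    [P.IsPrime] : (Localization.localRingHom (P.comap φ) P φ rfl).IsWeierstrass := by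
  intro x
  obtain ⟨⟨b, s⟩, rfl⟩ := IsLocalization.mk'_surjective P.primeCompl x
  obtain ⟨a, u, rfl⟩ := h b
  have hs := IsLocalization.map_units (Localization.AtPrime P) s
  refine ⟨algebraMap _ _ a, Units.map (algebraMap B _).toMonoidHom u * hs.unit⁻¹, ?_⟩
  rw [Localization.localRingHom_to_map, IsLocalization.mk'_eq_iff_eq_mul]
  simp [mul_assoc]

/-- For a flat local Weierstrass homomorphism to a Noetherian local ring `B`, either `B` is a
principal ideal ring or the extension of residue fields is trivial. -/
theorem IsLocalRing.isPrincipalIdealRing_or_of_isWeierstrass [Algebra A B] [Module.Flat A B]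
    [IsLocalRing A] [IsLocalRing B] [IsNoetherianRing B] [IsLocalHom (algebraMap A B)]
    (h : (algebraMap A B).IsWeierstrass) :
    IsPrincipalIdealRing B ∨
      ∀ u : B, ∃ c : A, u - algebraMap A B c ∈ IsLocalRing.maximalIdeal B := by
  rw [or_iff_not_imp_left]
  intro hB u
  have hff : Module.FaithfullyFlat A B := Module.FaithfullyFlat.of_flat_of_isLocalHom
  set φ := algebraMap A B
  obtain ⟨a₁, a₂, ha⟩ : ∃ a₁ a₂, ¬ (Ideal.span {φ a₁, φ a₂}).IsPrincipal := by
    by_contra! hcon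
    have : IsBezout B := IsBezout.iff_span_pair_isPrincipal.mpr fun x y => by
      obtain ⟨a₁, u₁, rfl⟩ := h x
      obtain ⟨a₂, u₂, rfl⟩ := h y
      rw [Ideal.span_insert, Ideal.span_singleton_mul_right_unit u₁.isUnit,
        Ideal.span_singleton_mul_right_unit u₂.isUnit, ← Ideal.span_insert]
      exact hcon a₁ a₂
    exact hB inferInstance
  obtain ⟨a, v, hav⟩ := h (φ a₁ + u * φ a₂)
  have hmem : a ∈ Ideal.span {a₁, a₂} := by
    rw [← Ideal.comap_map_eq_self_of_faithfullyFlat (B := B) (Ideal.span {a₁, a₂}),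
      Ideal.mem_comap, Ideal.map_span, Set.image_pair, Ideal.mem_span_pair]
    refine ⟨↑v⁻¹, ↑v⁻¹ * u, ?_⟩
    rw [mul_assoc, ← mul_add, hav, mul_left_comm, Units.inv_mul, mul_one]
  obtain ⟨c₁, c₂, rfl⟩ := Ideal.mem_span_pair.mp hmem
  simp only [map_add, map_mul] at hav
  have hrel : (1 - v * φ c₁) * φ a₁ + (u - v * φ c₂) * φ a₂ = 0 := by linear_combination hav
  have h₁ : 1 - v * φ c₁ ∈ IsLocalRing.maximalIdeal B := by
    intro hu
    have : φ a₂ ∣ φ a₁ := by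
      rw [← hu.dvd_mul_left]
      exact ⟨-(u - v * φ c₂), by linear_combination hrel⟩
    exact ha ⟨φ a₂, by rw [Ideal.span_pair_eq_span_right_iff_dvd.mpr this]⟩
  have h₂ : u - v * φ c₂ ∈ IsLocalRing.maximalIdeal B := by
    intro hu
    have : φ a₁ ∣ φ a₂ := by
      rw [← hu.dvd_mul_left]
      exact ⟨-(1 - v * φ c₁), by linear_combination hrel⟩
    exact ha ⟨φ a₁, by rw [Ideal.span_pair_eq_span_left_iff_dvd.mpr this]⟩
  have hc₁ : IsUnit c₁ := by
    refine (isUnit_map_iff φ c₁).mp (isUnit_of_mul_isUnit_right (x := (v : B)) ?_)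
    rcases IsLocalRing.isUnit_or_isUnit_one_sub_self (v * φ c₁) with hu | hu
    · exact hu
    · exact absurd hu h₁
  obtain ⟨w, rfl⟩ := hc₁
  refine ⟨c₂ * ↑w⁻¹, ?_⟩
  have hw : φ w * φ ↑w⁻¹ = 1 := by rw [← map_mul, Units.mul_inv, map_one]
  have := sub_mem h₂ (Ideal.mul_mem_left _ (φ c₂ * φ ↑w⁻¹) h₁)
  convert this using 1
  rw [map_mul]
  linear_combination (-(v : B) * φ c₂) * hw

end WeierstrassAux

/-- Theorem 2.3: a flat homomorphism `φ : A → B` of Noetherian rings with `B` local is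
Weierstrass iff every prime `P` of `B` satisfies (a) `P = φ(φ⁻¹(P))·B`, and (b) either `B_P`
is a principal ideal ring or the inclusion `k_A(φ⁻¹(P)) → k_B(P)` is an isomorphism. -/
theorem isWeierstrass_iff_of_flat {A B : Type*} [CommRing A] [CommRing B]
    [IsNoetherianRing A] [IsNoetherianRing B] [IsLocalRing B]
    (φ : A →+* B) (hflat : φ.IsFlat) :
    φ.IsWeierstrass ↔
      ∀ (P : Ideal B) [P.IsPrime],
        P = (P.comap φ).map φ ∧
          (IsPrincipalIdealRing (Localization.AtPrime P) ∨
            Function.Bijective (residueFieldInclusion φ P)) := by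
  constructor
  · intro h P _
    refine ⟨le_antisymm (fun b hb => ?_) Ideal.map_comap_le, ?_⟩
    · obtain ⟨a, u, rfl⟩ := h b
      refine Ideal.mul_mem_right _ _ (Ideal.mem_map_of_mem φ ?_)
      exact (Ideal.mul_unit_mem_iff_mem P u.isUnit).mp hb
    · have hloc := Localization.isLocalHom_localRingHom (P.comap φ) P φ rfl
      have hfl : (Localization.localRingHom (P.comap φ) P φ rfl).Flat :=
        RingHom.Flat.localRingHom (f := φ) hflat P _ rfl
      let := (Localization.localRingHom (P.comap φ) P φ rfl).toAlgebra
      have : Module.Flat (Localization.AtPrime (P.comap φ)) (Localization.AtPrime P) := hfl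
      have : IsLocalHom (algebraMap (Localization.AtPrime (P.comap φ))
        (Localization.AtPrime P)) := hloc
      refine (IsLocalRing.isPrincipalIdealRing_or_of_isWeierstrass (h.localRingHom P)).imp_right
        fun hres => ⟨RingHom.injective _, fun x => ?_⟩
      obtain ⟨u, rfl⟩ := IsLocalRing.residue_surjective x
      obtain ⟨c, hc⟩ := hres u
      refine ⟨IsLocalRing.residue _ c, ?_⟩
      rw [residueFieldInclusion, IsLocalRing.ResidueField.map_residue, eq_comm, ← sub_eq_zero,
        ← map_sub]
      exact (IsLocalRing.residue_eq_zero_iff _).mpr hc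
  · intro h
    let := φ.toAlgebra
    have : Module.Flat A B := hflat
    exact φ.isWeierstrass_of_forall_le_map_comap (Ideal.le_map_comap_of_forall_isPrime h)
end

section
/- Let φ: A → B be a flat homomorphism of Noetherian commutative rings (B not necessarily local) such that every prime ideal P of B satisfies: (a) P = φ(φ⁻¹(P))·B, and (b) either B_P is a principal ideal ring or the canonical inclusion of residue fields k_A(φ⁻¹(P)) → k_B(P) is an isomorphism. Then for every prime ideal Q of B, the composition φ_Q: A → B_Q of φ with the localization map B → B_Q is Weierstrass. -/
open IsLocalRing TensorProduct

section Flat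

variable {A B : Type*} [CommRing A] [CommRing B] [Algebra A B]

/-- If `I` annihilates `n`, then `y ⊗ n = 0` for every `y` in the extension of `I`. -/
theorem tmul_eq_zero_of_mem_map {N : Type*} [AddCommGroup N] [Module A N]
    {I : Ideal A} {n : N} (hI : ∀ a ∈ I, a • n = 0) {y : B} (hy : y ∈ I.map (algebraMap A B)) :
    y ⊗ₜ[A] n = 0 := by
  induction hy using Submodule.span_induction with
  | mem x hx =>
    obtain ⟨a, ha, rfl⟩ := hx
    rw [Algebra.algebraMap_eq_smul_one, TensorProduct.smul_tmul, hI a ha, TensorProduct.tmul_zero]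
  | zero => exact TensorProduct.zero_tmul _ _
  | add x z _ _ hx hz => rw [TensorProduct.add_tmul, hx, hz, add_zero]
  | smul c x _ hx =>
    have := congrArg (c • ·) hx
    simpa [TensorProduct.smul_tmul'] using this

/-- Over a flat algebra, `y ⊗ n = 0` only if `y` lies in the extension of the annihilator of `n`. -/
theorem mem_map_of_tmul_eq_zero [Module.Flat A B] {N : Type*} [AddCommGroup N] [Module A N]
    {I : Ideal A} {n : N} (hI : ∀ a, a • n = 0 → a ∈ I) {y : B} (hy : y ⊗ₜ[A] n = 0) :
    y ∈ I.map (algebraMap A B) := by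
  have hker : y ⊗ₜ[A] (1 : A) ∈
      LinearMap.ker (AlgebraTensorModule.lTensor B B (LinearMap.toSpanSingleton A N n)) := by
    simpa using hy
  rw [Module.Flat.ker_lTensor_eq] at hker
  obtain ⟨z, hz⟩ := hker
  have key : ∀ z : B ⊗[A] LinearMap.ker (LinearMap.toSpanSingleton A N n),
      TensorProduct.rid A B (AlgebraTensorModule.lTensor B B
        (LinearMap.ker (LinearMap.toSpanSingleton A N n)).subtype z) ∈
        I.map (algebraMap A B) := by
    intro z
    induction z with
    | zero => simp
    | add z w hz hw => simpa using add_mem hz hw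
    | tmul b a =>
      have ha : (a : A) ∈ I := hI a (LinearMap.mem_ker.mp a.2)
      simpa [Algebra.smul_def] using Ideal.mul_mem_right b _ (Ideal.mem_map_of_mem _ ha)
  simpa [hz] using key z

/-- Extension of ideals along a flat algebra commutes with binary intersections. -/
theorem map_inf_of_flat [Module.Flat A B] (I J : Ideal A) :
    (I ⊓ J).map (algebraMap A B) = I.map (algebraMap A B) ⊓ J.map (algebraMap A B) := by
  refine le_antisymm (Ideal.map_inf_le _) fun y hy ↦ ?_
  refine mem_map_of_tmul_eq_zero (N := (A ⧸ I) × (A ⧸ J)) (n := (1, 1)) (fun a ha ↦ ?_) ?_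
  · simpa [Prod.ext_iff, Algebra.smul_def, Ideal.Quotient.eq_zero_iff_mem] using ha
  · have h₁ : y ⊗ₜ[A] ((1, 0) : (A ⧸ I) × (A ⧸ J)) = 0 :=
      tmul_eq_zero_of_mem_map (fun a ha ↦ by
        simpa [Prod.ext_iff, Algebra.smul_def, Ideal.Quotient.eq_zero_iff_mem] using ha) hy.1
    have h₂ : y ⊗ₜ[A] ((0, 1) : (A ⧸ I) × (A ⧸ J)) = 0 :=
      tmul_eq_zero_of_mem_map (fun a ha ↦ by
        simpa [Prod.ext_iff, Algebra.smul_def, Ideal.Quotient.eq_zero_iff_mem] using ha) hy.2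
    simpa [← TensorProduct.tmul_add] using congrArg₂ (· + ·) h₁ h₂

/-- An element that is regular modulo `q` stays regular modulo the extension of `q` along a flat
algebra. -/
theorem mem_map_of_algebraMap_mul_mem_map [Module.Flat A B] {q : Ideal A} {a : A}
    (ha : ∀ c, c * a ∈ q → c ∈ q) {y : B}
    (hy : algebraMap A B a * y ∈ q.map (algebraMap A B)) : y ∈ q.map (algebraMap A B) := by
  refine mem_map_of_tmul_eq_zero (n := Ideal.Quotient.mk q a) (fun c hc ↦ ha c ?_) ?_
  · simpa [Algebra.smul_def, ← map_mul, Ideal.Quotient.eq_zero_iff_mem] using hc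
  · have h : (algebraMap A B a * y) ⊗ₜ[A] (1 : A ⧸ q) = 0 :=
      tmul_eq_zero_of_mem_map (fun c hc ↦ by
        simpa [Algebra.smul_def, Ideal.Quotient.eq_zero_iff_mem] using hc) hy
    rw [← Algebra.smul_def, TensorProduct.smul_tmul] at h
    simpa [Algebra.smul_def] using h

/-- If every prime of `B` is extended from `A`, then along a flat map the extension of a primary
ideal with radical `p` is primary with respect to `pB`. -/
theorem mem_map_of_mul_mem_map_of_isPrimary [Module.Flat A B] [IsNoetherianRing B]
    (ha : ∀ P : Ideal B, P.IsPrime → P ≤ (P.comap (algebraMap A B)).map (algebraMap A B))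
    {q : Ideal A} (hq : q.IsPrimary) {u y : B} (hu : u ∉ q.radical.map (algebraMap A B))
    (huy : u * y ∈ q.map (algebraMap A B)) : y ∈ q.map (algebraMap A B) := by
  by_contra hy
  obtain ⟨P, hP, hle⟩ := exists_le_isAssociatedPrime_of_isNoetherianRing B
    (Ideal.Quotient.mk (q.map (algebraMap A B)) y) (by rwa [Ne, Ideal.Quotient.eq_zero_iff_mem])
  obtain ⟨hprime, z, hz⟩ := isAssociatedPrime_iff.mp hP
  obtain ⟨z, rfl⟩ := Ideal.Quotient.mk_surjective z
  have hmem : ∀ c, c ∈ P ↔ c * z ∈ q.map (algebraMap A B) := fun c ↦ by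
    rw [hz, Submodule.mem_colon_singleton, Submodule.mem_bot, Algebra.smul_def,
      Ideal.Quotient.algebraMap_eq, ← map_mul, Ideal.Quotient.eq_zero_iff_mem]
  have hz' : z ∉ q.map (algebraMap A B) := fun h ↦
    hprime.ne_top ((Ideal.eq_top_iff_one _).mpr ((hmem 1).mpr (by simpa using h)))
  have huP : u ∈ P := hle <| by
    rw [Submodule.mem_colon_singleton, Submodule.mem_bot, Algebra.smul_def,
      Ideal.Quotient.algebraMap_eq, ← map_mul, Ideal.Quotient.eq_zero_iff_mem]
    exact huy
  refine hu (Ideal.map_mono (fun a haP ↦ ?_) (ha P hprime huP))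
  by_contra har
  exact hz' (mem_map_of_algebraMap_mul_mem_map
    (fun c hc ↦ ((Ideal.isPrimary_iff.mp hq).2 hc).resolve_right har) ((hmem _).mp haP))

end Flat

section LocalRing

variable {S R : Type*} [CommRing S] [CommRing R] [IsLocalRing S] [IsLocalRing R]

/-- In a local ring with principal maximal ideal, an ideal containing a power of the maximal ideal
is itself a power of the maximal ideal. -/
theorem exists_eq_maximalIdeal_pow_of_isPrincipal (hm : (maximalIdeal R).IsPrincipal)
    {I : Ideal R} (hI : ∃ n, maximalIdeal R ^ n ≤ I) : ∃ k, I = maximalIdeal R ^ k := by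
  classical
  obtain ⟨x, hx : _ = Ideal.span _⟩ := hm
  refine ⟨Nat.find hI, le_antisymm (fun y hy ↦ ?_) (Nat.find_spec hI)⟩
  have key : ∀ j ≤ Nat.find hI, y ∈ maximalIdeal R ^ j := by
    intro j
    induction j with
    | zero => simp
    | succ j ih =>
      intro hj
      have hyj := ih (by omega)
      rw [hx, Ideal.span_singleton_pow, Ideal.mem_span_singleton] at hyj
      obtain ⟨c, rfl⟩ := hyj
      by_cases hc : IsUnit c
      · refine absurd ?_ (Nat.find_min hI hj)
        rw [hx, Ideal.span_singleton_pow, Ideal.span_singleton_le_iff_mem]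
        exact (Ideal.mul_unit_mem_iff_mem I hc).mp hy
      · rw [pow_succ]
        exact Ideal.mul_mem_mul
          (Ideal.pow_mem_pow (hx ▸ Ideal.mem_span_singleton_self x) j)
          ((mem_maximalIdeal c).mpr hc)
  exact key _ le_rfl

/-- If `S → R` is surjective modulo the maximal ideal of `R`, which is extended from `S`, then it is
surjective modulo all powers of that maximal ideal. -/
theorem exists_sub_mem_maximalIdeal_pow {f : S →+* R}
    (hm : (maximalIdeal S).map f = maximalIdeal R)
    (hf : ∀ y, ∃ s, y - f s ∈ maximalIdeal R) (n : ℕ) (y : R) :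
    ∃ s, y - f s ∈ maximalIdeal R ^ n := by
  induction n with
  | zero => simp
  | succ n ih =>
    have key : ∀ z ∈ maximalIdeal R ^ n, ∃ s, z - f s ∈ maximalIdeal R ^ (n + 1) := by
      intro z hz
      rw [← hm, ← Ideal.map_pow] at hz
      induction hz using Submodule.closure_induction with
      | zero => exact ⟨0, by simp⟩
      | add z w _ _ hz hw =>
        obtain ⟨s, hs⟩ := hz
        obtain ⟨t, ht⟩ := hw
        exact ⟨s + t, by simpa [add_sub_add_comm] using add_mem hs ht⟩
      | smul_mem r x hx =>
        obtain ⟨g, hg, rfl⟩ := hx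
        obtain ⟨s, hs⟩ := hf r
        refine ⟨s * g, ?_⟩
        rw [smul_eq_mul, map_mul, ← sub_mul, pow_succ', ← hm, ← Ideal.map_pow, hm]
        exact Ideal.mul_mem_mul hs (Ideal.mem_map_of_mem f hg)
    obtain ⟨s, hs⟩ := ih
    obtain ⟨t, ht⟩ := key _ hs
    exact ⟨s + t, by rwa [map_add, ← sub_sub]⟩

/-- An ideal of `R` containing a power of the maximal ideal is extended from `S` if the maximal
ideal is, and either it is principal or `S → R` is surjective on residue fields. -/
theorem le_map_comap_of_maximalIdeal_pow_le {f : S →+* R}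
    (hm : (maximalIdeal S).map f = maximalIdeal R)
    (hf : (maximalIdeal R).IsPrincipal ∨ ∀ y, ∃ s, y - f s ∈ maximalIdeal R)
    {I : Ideal R} {n : ℕ} (hI : maximalIdeal R ^ n ≤ I) : I ≤ (I.comap f).map f := by
  have hpow : ∀ k, maximalIdeal R ^ k ≤ I → maximalIdeal R ^ k ≤ (I.comap f).map f := by
    intro k hk
    rw [← hm, ← Ideal.map_pow] at hk ⊢
    exact Ideal.map_mono (Ideal.map_le_iff_le_comap.mp hk)
  rcases hf with hf | hf
  · obtain ⟨k, hk⟩ := exists_eq_maximalIdeal_pow_of_isPrincipal hf ⟨n, hI⟩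
    exact hk.le.trans (hpow k hk.ge)
  · intro y hy
    obtain ⟨s, hs⟩ := exists_sub_mem_maximalIdeal_pow hm hf n y
    have hfs : f s ∈ I := by simpa using sub_mem hy (hI hs)
    simpa using add_mem (hpow n hI hs) (Ideal.mem_map_of_mem f (Ideal.mem_comap.mpr hfs))

/-- A ring map to a local ring is Weierstrass if every ideal is extended. -/
theorem RingHom.IsWeierstrass.of_le_map_comap {A : Type*} [CommRing A] {f : A →+* R}
    (hf : ∀ I : Ideal R, I ≤ (I.comap f).map f) : f.IsWeierstrass := by
  intro b
  by_cases h : ∃ a c, IsUnit c ∧ f a = b * c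
  · obtain ⟨a, c, ⟨c, rfl⟩, hc⟩ := h
    exact ⟨a, c⁻¹, by simp [hc]⟩
  · push Not at h
    have hle : ((Ideal.span {b}).comap f).map f ≤ Ideal.span {b} * maximalIdeal R := by
      rw [Ideal.map_le_iff_le_comap]
      intro a ha
      obtain ⟨c, hc⟩ := Ideal.mem_span_singleton.mp (Ideal.mem_comap.mp ha)
      rw [Ideal.mem_comap, hc]
      exact Ideal.mul_mem_mul (Ideal.mem_span_singleton_self b)
        ((mem_maximalIdeal c).mpr fun hu ↦ h a c hu hc)
    obtain ⟨c, hc, hcb⟩ := Ideal.mem_span_singleton_mul.mp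
      (hle (hf _ (Ideal.mem_span_singleton_self b)))
    have hu : IsUnit (1 - c) := by
      by_contra hn
      exact (Ideal.ne_top_iff_one _).mp (maximalIdeal.isMaximal R).ne_top
        (by simpa using add_mem ((mem_maximalIdeal _).mpr hn) hc)
    have hb : b = 0 := hu.mul_left_eq_zero.mp (by rw [mul_sub, hcb, mul_one, sub_self])
    exact ⟨0, 1, by simp [hb]⟩

end LocalRing

/-- Let `B` be a flat Noetherian `A`-algebra whose primes are extended from `A` and have principal
localization or trivial residue field extension. Then primary ideals of `B` are extended from `A`. -/
theorem Ideal.IsPrimary.le_map_comap {A B : Type*} [CommRing A] [CommRing B] [IsNoetherianRing B]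
    [Algebra A B] [Module.Flat A B]
    (ha : ∀ P : Ideal B, P.IsPrime → P ≤ (P.comap (algebraMap A B)).map (algebraMap A B))
    (hb : ∀ (P : Ideal B) [P.IsPrime],
      IsPrincipalIdealRing (Localization.AtPrime P) ∨
        Function.Bijective (residueFieldInclusion (algebraMap A B) P))
    {J : Ideal B} (hJ : J.IsPrimary) :
    J ≤ (J.comap (algebraMap A B)).map (algebraMap A B) := by
  have hP := Ideal.isPrime_radical hJ
  obtain ⟨P, hPJ⟩ : ∃ P, P = J.radical := ⟨_, rfl⟩
  rw [← hPJ] at hP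
  let p := P.comap (algebraMap A B)
  let f := Localization.localRingHom p P (algebraMap A B) rfl
  have hcomp : f.comp (algebraMap A (Localization.AtPrime p)) =
      (algebraMap B (Localization.AtPrime P)).comp (algebraMap A B) :=
    RingHom.ext fun a ↦ Localization.localRingHom_to_map p P (algebraMap A B) rfl a
  have hm : (maximalIdeal (Localization.AtPrime p)).map f =
      maximalIdeal (Localization.AtPrime P) := by
    rw [← Localization.AtPrime.map_eq_maximalIdeal, Ideal.map_map, hcomp, ← Ideal.map_map,
      le_antisymm Ideal.map_comap_le (ha P hP), Localization.AtPrime.map_eq_maximalIdeal]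
  have hf : (maximalIdeal (Localization.AtPrime P)).IsPrincipal ∨
      ∀ y, ∃ s, y - f s ∈ maximalIdeal (Localization.AtPrime P) := by
    refine (hb P).imp (fun h ↦ h.principal _) fun h y ↦ ?_
    obtain ⟨s, hs⟩ := h.2 (residue _ y)
    obtain ⟨s, rfl⟩ := residue_surjective s
    refine ⟨s, ?_⟩
    rw [← residue_eq_zero_iff, map_sub, sub_eq_zero]
    exact hs.symm
  obtain ⟨n, hn⟩ := J.exists_radical_pow_le_of_fg (IsNoetherian.noetherian _)
  have hI : maximalIdeal (Localization.AtPrime P) ^ n ≤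
      J.map (algebraMap B (Localization.AtPrime P)) := by
    rw [← Localization.AtPrime.map_eq_maximalIdeal, ← Ideal.map_pow]
    exact Ideal.map_mono (hPJ ▸ hn)
  have hdisj : Disjoint (P.primeCompl : Set B) J :=
    Set.disjoint_left.mpr fun x hx hxJ ↦ hx (hPJ ▸ Ideal.le_radical hxJ)
  have hcomap : ((J.map (algebraMap B (Localization.AtPrime P))).comap f).comap
      (algebraMap A (Localization.AtPrime p)) = J.comap (algebraMap A B) := by
    rw [Ideal.comap_comap, hcomp, ← Ideal.comap_comap]
    exact congrArg _ (IsLocalization.under_map_of_isPrimary_disjoint P.primeCompl _ hJ hdisj)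
  intro y hy
  have hmem := le_map_comap_of_maximalIdeal_pow_le hm hf hI (Ideal.mem_map_of_mem _ hy)
  rw [← IsLocalization.map_under p.primeCompl _ (Ideal.comap f _), Ideal.under, hcomap,
    Ideal.map_map, hcomp, ← Ideal.map_map,
    IsLocalization.algebraMap_mem_map_algebraMap_iff P.primeCompl] at hmem
  obtain ⟨u, hu, huy⟩ := hmem
  refine mem_map_of_mul_mem_map_of_isPrimary ha (hJ.comap _) (fun h ↦ hu ?_) huy
  rw [← Ideal.comap_radical, ← hPJ] at h
  exact Ideal.map_comap_le h

/-- Let `B` be a flat Noetherian `A`-algebra whose primes are extended from `A` and have principal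
localization or trivial residue field extension. Then all ideals of `B` are extended from `A`. -/
theorem Ideal.le_map_comap_of_flat {A B : Type*} [CommRing A] [CommRing B] [IsNoetherianRing B]
    [Algebra A B] [Module.Flat A B]
    (ha : ∀ P : Ideal B, P.IsPrime → P ≤ (P.comap (algebraMap A B)).map (algebraMap A B))
    (hb : ∀ (P : Ideal B) [P.IsPrime],
      IsPrincipalIdealRing (Localization.AtPrime P) ∨
        Function.Bijective (residueFieldInclusion (algebraMap A B) P))
    (J : Ideal B) : J ≤ (J.comap (algebraMap A B)).map (algebraMap A B) := by
  classical
  obtain ⟨s, rfl, hs⟩ := Submodule.isLasker B B J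
  induction s using Finset.induction_on with
  | empty =>
    change (⊤ : Ideal B) ≤ (Ideal.comap (algebraMap A B) ⊤).map (algebraMap A B)
    rw [Ideal.comap_top, Ideal.map_top]
  | insert I s _ ih =>
    rw [Finset.inf_insert, id, Ideal.comap_inf, map_inf_of_flat]
    exact inf_le_inf (Ideal.IsPrimary.le_map_comap ha hb (hs (Finset.mem_insert_self I s)))
      (ih fun K hK ↦ hs (Finset.mem_insert_of_mem hK))

/-- Remark 2.7: if `φ : A → B` is a flat homomorphism of Noetherian rings (with `B` not
necessarily local) such that every prime `P` of `B` satisfies (a) `P = φ(φ⁻¹(P))·B` and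
(b) either `B_P` is a principal ideal ring or `k_A(φ⁻¹(P)) → k_B(P)` is an isomorphism,
then for every prime `Q` of `B` the composition `A → B → B_Q` is Weierstrass. -/
theorem isWeierstrass_comp_localization {A B : Type*} [CommRing A] [CommRing B]
    [IsNoetherianRing A] [IsNoetherianRing B]
    (φ : A →+* B) (hflat : φ.IsFlat)
    (ha : ∀ (P : Ideal B) [P.IsPrime], P = (P.comap φ).map φ)
    (hb : ∀ (P : Ideal B) [P.IsPrime],
      IsPrincipalIdealRing (Localization.AtPrime P) ∨
        Function.Bijective (residueFieldInclusion φ P)) :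
    ∀ (Q : Ideal B) [Q.IsPrime],
      ((algebraMap B (Localization.AtPrime Q)).comp φ).IsWeierstrass := by
  intro Q _
  algebraize [φ]
  have : Module.Flat A B := hflat
  have key : ∀ J : Ideal B, J ≤ (J.comap φ).map φ :=
    Ideal.le_map_comap_of_flat (fun P _ ↦ (ha P).le) hb
  refine RingHom.IsWeierstrass.of_le_map_comap fun I ↦ ?_
  rw [← Ideal.comap_comap, ← Ideal.map_map]
  refine le_trans ?_ (Ideal.map_mono (key _))
  exact (IsLocalization.map_under Q.primeCompl _ I).ge
end

section
/- Let (A, m_A) ⊆ (B, m_B) be a faithfully flat Weierstrass extension of Noetherian local rings with B henselian. Then the canonical map ψ: A^h → B from the Henselization A^h of A to B (given by the universal property of Henselization) is an injective faithfully flat homomorphism, giving faithfully flat embeddings A ↪ A^h ↪ B whose composition is the inclusion A ⊆ B. If moreover B is not a principal ideal ring, then there are faithfully flat embeddings A^h ↪ B ↪ Â, where Â is the m_A-adic completion of A. Moreover, the Henselization map A → A^h is Weierstrass. -/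
universe u

/-- A ring homomorphism `φ : A → B` is faithfully flat if `B` is a faithfully flat `A`-module
via `φ`. -/
def RingHom.IsFaithfullyFlat {A B : Type*} [CommRing A] [CommRing B] (φ : A →+* B) : Prop :=
  letI := φ.toAlgebra
  Module.FaithfullyFlat A B

/-- `ι : A → Ah` realizes `Ah` as the Henselization of the local ring `A`: `Ah` is a henselian
local ring, `ι` is a local homomorphism, and `ι` is universal among local homomorphisms from `A`
to henselian local rings. -/
def IsHenselization {A Ah : Type u} [CommRing A] [IsLocalRing A] [CommRing Ah]
    [HenselianLocalRing Ah] (ι : A →+* Ah) : Prop :=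
  IsLocalHom ι ∧
    ∀ (B : Type u) [CommRing B] [HenselianLocalRing B] (f : A →+* B), IsLocalHom f →
      ∃! g : Ah →+* B, IsLocalHom g ∧ g.comp ι = f

open IsLocalRing Polynomial TensorProduct

/-- Flatness of `A → B` descends to `A → H` along a faithfully flat map `H → B`. -/
lemma RingHom.Flat.of_comp_of_faithfullyFlat {A H B : Type*} [CommRing A] [CommRing H]
    [CommRing B] {f : A →+* H} {g : H →+* B} (hgf : (g.comp f).Flat) (hg : g.FaithfullyFlat) :
    f.Flat := by
  algebraize [f, g, g.comp f]
  rw [RingHom.Flat, Module.Flat.iff_lTensor_preserves_injective_linearMap]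
  intro N P _ _ _ _ i hi
  change Function.Injective (AlgebraTensorModule.lTensor H H i)
  rw [← Module.FaithfullyFlat.lTensor_injective_iff_injective H B]
  have key : (AlgebraTensorModule.lTensor H H i).lTensor B =
      (AlgebraTensorModule.cancelBaseChange A H H B P).symm.toLinearMap ∘ₗ
        AlgebraTensorModule.lTensor H B i ∘ₗ
          (AlgebraTensorModule.cancelBaseChange A H H B N).toLinearMap := by
    ext b n
    simp
  rw [key]
  simpa using Module.Flat.lTensor_preserves_injective_linearMap (M := B) i hi

lemma RingHom.Flat.faithfullyFlat_of_isLocalHom {A B : Type*} [CommRing A] [CommRing B]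
    [IsLocalRing A] [IsLocalRing B] {f : A →+* B} (hf : f.Flat) [hloc : IsLocalHom f] :
    f.FaithfullyFlat := by
  algebraize [f]
  have : IsLocalHom (algebraMap A B) := hloc
  exact Module.FaithfullyFlat.of_flat_of_isLocalHom

/-- A ring map out of a directed union of subrings is flat if it is so on every subring. -/
lemma RingHom.Flat.of_directedOn_sSup {H B : Type*} [CommRing H] [CommRing B] (g : H →+* B)
    {c : Set (Subring H)} (hne : c.Nonempty) (hc : DirectedOn (· ≤ ·) c)
    (hflat : ∀ R ∈ c, (g.comp R.subtype).Flat) : (g.comp (sSup c).subtype).Flat := by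
  let _ : Algebra (sSup c : Subring H) B := (g.comp (sSup c).subtype).toAlgebra
  refine Module.Flat.of_forall_isTrivialRelation fun {l f x} hfx ↦ ?_
  have hmem : ∀ t : Finset (Fin l), ∃ R ∈ c, ∀ i ∈ t, (f i : H) ∈ R := by
    classical
    intro t
    induction t using Finset.induction_on with
    | empty => exact ⟨_, hne.some_mem, by simp⟩
    | insert i t _ ih =>
      obtain ⟨R, hR, hRt⟩ := ih
      obtain ⟨R', hR', hi⟩ := (Subring.mem_sSup_of_directedOn hne hc).mp (f i).2
      obtain ⟨T, hT, h1, h2⟩ := hc R hR R' hR'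
      refine ⟨T, hT, fun j hj ↦ ?_⟩
      rcases Finset.mem_insert.mp hj with rfl | hj
      exacts [h2 hi, h1 (hRt j hj)]
  obtain ⟨R, hR, hfR⟩ := hmem Finset.univ
  let _ : Algebra R B := (g.comp R.subtype).toAlgebra
  have : Module.Flat R B := hflat R hR
  obtain ⟨κ, a, y, h1, h2⟩ := Module.Flat.isTrivialRelation_of_sum_smul_eq_zero
    (f := fun i ↦ (⟨f i, hfR i (Finset.mem_univ i)⟩ : R)) (x := x) hfx
  refine ⟨κ, fun i j ↦ ⟨a i j, le_sSup hR (a i j).2⟩, y, h1, fun j ↦ ?_⟩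
  have := congrArg (fun z : R ↦ (z : H)) (h2 j)
  ext
  simpa using this

/-- If `R → B` is flat, then so is any map to `B` from an étale `R`-algebra. -/
lemma RingHom.Flat.of_comp_etale {R S B : Type*} [CommRing R] [CommRing S] [CommRing B]
    [Algebra R S] [Algebra.Etale R S] {g : S →+* B} (h : (g.comp (algebraMap R S)).Flat) :
    g.Flat := by
  let _ : Algebra S B := g.toAlgebra
  let _ : Algebra R B := (g.comp (algebraMap R S)).toAlgebra
  have : IsScalarTower R S B := .of_algebraMap_eq' rfl
  have : Module.Flat R B := h
  exact Algebra.FormallyUnramified.flat_of_restrictScalars R S B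

/-- Flatness of a ring map out of a localization may be tested before localizing. -/
lemma RingHom.Flat.of_comp_localization {R S B : Type*} [CommRing R] [CommRing S] [CommRing B]
    [Algebra R S] (M : Submonoid R) [IsLocalization M S] {g : S →+* B}
    (h : (g.comp (algebraMap R S)).Flat) : g.Flat := by
  let _ : Algebra S B := g.toAlgebra
  let _ : Algebra R B := (g.comp (algebraMap R S)).toAlgebra
  have : IsScalarTower R S B := .of_algebraMap_eq' rfl
  have : Module.Flat R B := h
  exact (Module.flat_iff_of_isLocalization S M B).mpr this

/-- A ring map `l : R → H` to a local ring extends to a local map out of the localization of `R` at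
the preimage of the maximal ideal of `H`. -/
lemma exists_isLocalHom_localization_atPrime {R H : Type*} [CommRing R] [CommRing H]
    [IsLocalRing H] (l : R →+* H) :
    ∃ l' : Localization.AtPrime ((maximalIdeal H).comap l) →+* H,
      IsLocalHom l' ∧ l'.comp (algebraMap R _) = l := by
  set q := (maximalIdeal H).comap l
  have hu : ∀ y : q.primeCompl, IsUnit (l y) := fun y ↦ by
    have := y.2
    rw [Ideal.mem_primeCompl_iff, Ideal.mem_comap] at this
    exact notMem_maximalIdeal.mp this
  refine ⟨IsLocalization.lift hu, ⟨fun x hx ↦ ?_⟩, IsLocalization.lift_comp hu⟩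
  obtain ⟨a, s, rfl⟩ := IsLocalization.exists_mk'_eq q.primeCompl x
  rw [IsLocalization.lift_mk'] at hx
  have ha : IsUnit (l a) := isUnit_of_mul_isUnit_left hx
  rw [IsLocalization.AtPrime.isUnit_mk'_iff _ q]
  exact fun h ↦ notMem_maximalIdeal.mpr ha h

/-- Let `g : H → B` be a local map of local rings, and `R ⊆ H` a subring closed under inverses
over which `B` is flat. Then a simple root in `H` of a monic polynomial over `R` lies in a larger
such subring. -/
lemma Subring.exists_le_flat_mem_of_isRoot {H B : Type*} [CommRing H] [IsLocalRing H]
    [CommRing B] [IsLocalRing B] (g : H →+* B) [IsLocalHom g] (R : Subring H)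
    (hR : (g.comp R.subtype).Flat) {f : R[X]} (hf : f.Monic) {r : H} (hr : aeval r f = 0)
    (hr' : IsUnit (aeval r (derivative f))) :
    ∃ S : Subring H, R ≤ S ∧ r ∈ S ∧ IsLocalHom S.subtype ∧ (g.comp S.subtype).Flat := by
  let P : StandardEtalePair R := ⟨f, hf, derivative f, 1, 0, 1, by simp⟩
  let l : P.Ring →ₐ[R] H := P.lift r ⟨hr, hr'⟩
  have hlX : l P.X = r := P.lift_X r ⟨hr, hr'⟩
  obtain ⟨l', hl', hll'⟩ := exists_isLocalHom_localization_atPrime l.toRingHom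
  have hl'l (x : P.Ring) : l' (algebraMap _ _ x) = l x := congr($hll' x)
  have hflat : (g.comp l').Flat := by
    refine .of_comp_localization ((maximalIdeal H).comap l.toRingHom).primeCompl ?_
    rw [RingHom.comp_assoc, hll']
    refine .of_comp_etale (R := R) ?_
    convert hR
    ext x
    exact congrArg g (l.commutes x)
  have hinj : Function.Injective l' :=
    .of_comp (f := g) (hflat.faithfullyFlat_of_isLocalHom).injective
  have hbij : Function.Bijective l'.rangeRestrict :=
    ⟨fun x y h ↦ hinj congr(($h : H)), l'.rangeRestrict_surjective⟩
  refine ⟨l'.range, fun x hx ↦ ⟨algebraMap _ _ (algebraMap R P.Ring ⟨x, hx⟩), ?_⟩,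
    ⟨algebraMap _ _ P.X, ?_⟩, ⟨?_⟩, ?_⟩
  · rw [hl'l, l.commutes]; rfl
  · rw [hl'l, hlX]
  · rintro ⟨_, x, rfl⟩ hx
    exact ((hl'.map_nonunit x hx).map l'.rangeRestrict)
  · exact (RingHom.Flat.comp_iff_of_bijective_right hbij).mp hflat

section Henselization

variable {A B Ah : Type u} [CommRing A] [IsLocalRing A] [CommRing Ah] [HenselianLocalRing Ah]
  [CommRing B]

/-- A henselian subring of the Henselization containing the base ring is everything. -/
lemma IsHenselization.subring_eq_top {ι : A →+* Ah} (hH : IsHenselization ι) (R : Subring Ah)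
    (hιR : ι.range ≤ R) [IsLocalHom R.subtype] (hR : HenselianLocalRing R) : R = ⊤ := by
  have hmem (a : A) : ι a ∈ R := hιR ⟨a, rfl⟩
  have hloc' : IsLocalHom (ι.codRestrict R hmem) :=
    ⟨fun a ha ↦ hH.1.map_nonunit a (ha.map R.subtype)⟩
  obtain ⟨g, ⟨hg, hgι⟩, -⟩ := hH.2 R (ι.codRestrict R hmem) hloc'
  have h : R.subtype.comp g = RingHom.id Ah := by
    refine (hH.2 Ah ι hH.1).unique ⟨inferInstance, ?_⟩ ⟨⟨fun a ha ↦ ha⟩, rfl⟩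
    rw [RingHom.comp_assoc, hgι]
    rfl
  refine eq_top_iff.mpr fun x _ ↦ ?_
  have hx : (g x : Ah) = x := congr($h x)
  exact hx ▸ (g x).2

/-- If a local ring `B` is flat over `A`, then it is flat over the Henselization of `A`. -/
lemma IsHenselization.flat_of_comp [IsLocalRing B] {ι : A →+* Ah} (hH : IsHenselization ι)
    (ψ : Ah →+* B) [IsLocalHom ψ] (hψ : (ψ.comp ι).Flat) : ψ.Flat := by
  have := hH.1
  have hbij : Function.Bijective ι.rangeRestrict :=
    ⟨fun x y h ↦ (.of_comp (f := ψ) hψ.faithfullyFlat_of_isLocalHom.injective :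
      Function.Injective ι) congr(($h : Ah)), ι.rangeRestrict_surjective⟩
  have hrange : IsLocalHom ι.range.subtype := by
    refine ⟨?_⟩
    rintro ⟨_, a, rfl⟩ ha
    exact (hH.1.map_nonunit a ha).map ι.rangeRestrict
  obtain ⟨R, hιR, hmax⟩ := zorn_le_nonempty₀
    {R : Subring Ah | IsLocalHom R.subtype ∧ (ψ.comp R.subtype).Flat}
    (fun c hc hchain y hy ↦ by
      have hdir := hchain.directedOn
      refine ⟨sSup c, ⟨⟨fun x hx ↦ ?_⟩, .of_directedOn_sSup ψ ⟨y, hy⟩ hdir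
        fun R hR ↦ (hc hR).2⟩, fun _ ↦ le_sSup⟩
      obtain ⟨R, hR, hxR⟩ := (Subring.mem_sSup_of_directedOn ⟨y, hy⟩ hdir).mp x.2
      exact ((hc hR).1.map_nonunit ⟨x, hxR⟩ hx).map (Subring.inclusion (le_sSup hR))) ι.range
    ⟨hrange, (RingHom.Flat.comp_iff_of_bijective_right hbij).mp hψ⟩
  obtain ⟨hRloc, hRflat⟩ := hmax.1
  have hRlocal : IsLocalRing R := R.subtype.domain_isLocalRing
  have hRhens : HenselianLocalRing R := by
    refine ⟨fun f hf a₀ ha₀ ha₀' ↦ ?_⟩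
    have hev (p : R[X]) (a : R) : (p.map R.subtype).eval (a : Ah) = (p.eval a : R) :=
      eval_map_apply R.subtype a
    have haev (p : R[X]) (x : Ah) : aeval x p = (p.map R.subtype).eval x :=
      (eval_map_algebraMap p x).symm
    have hmem (a : R) : (a : Ah) ∈ maximalIdeal Ah ↔ a ∈ maximalIdeal R := by
      simp only [mem_maximalIdeal, mem_nonunits_iff, not_iff_not]
      exact isUnit_map_iff R.subtype a
    obtain ⟨r, hr, hra₀⟩ := HenselianLocalRing.is_henselian (f.map R.subtype) (hf.map _)
      (a₀ : Ah) (by rwa [hev, hmem])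
      (by rw [derivative_map, hev]; exact ha₀'.map R.subtype)
    have hr' : IsUnit (aeval r (derivative f)) := by
      rw [haev, ← notMem_maximalIdeal]
      intro h
      have h2 := (maximalIdeal Ah).mem_of_dvd
        (sub_dvd_eval_sub r (a₀ : Ah) ((derivative f).map R.subtype)) hra₀
      have h3 : ((derivative f).map R.subtype).eval (a₀ : Ah) ∈ maximalIdeal Ah := by
        simpa using (maximalIdeal Ah).sub_mem h h2
      rw [hev, hmem] at h3
      exact h3 ha₀'
    obtain ⟨S, hRS, hrS, hS⟩ := R.exists_le_flat_mem_of_isRoot ψ hRflat hf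
      ((haev f r).trans hr) hr'
    have hrR : r ∈ R := hmax.2 hS hRS hrS
    refine ⟨⟨r, hrR⟩, ?_, (hmem _).mp hra₀⟩
    exact Subtype.ext ((hev f ⟨r, hrR⟩).symm.trans hr)
  have hRtop := hH.subring_eq_top R hιR hRhens
  subst hRtop
  exact (RingHom.Flat.comp_iff_of_bijective_right
    (g := (⊤ : Subring Ah).subtype) Subring.topEquiv.bijective).mp hRflat

end Henselization

/-- A Noetherian local ring whose maximal ideal is principal is a principal ideal ring. -/
lemma IsLocalRing.isPrincipalIdealRing_of_isPrincipal_maximalIdeal {B : Type*} [CommRing B]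
    [IsNoetherianRing B] [IsLocalRing B] (h : (maximalIdeal B).IsPrincipal) :
    IsPrincipalIdealRing B := by
  obtain ⟨t, ht⟩ := h
  refine .of_prime fun P hP ↦ ?_
  by_cases htP : t ∈ P
  · have hPm : P = maximalIdeal B := le_antisymm (le_maximalIdeal hP.ne_top)
      (ht ▸ (Ideal.span_singleton_le_iff_mem P).mpr htP)
    exact ⟨t, hPm.trans ht⟩
  · have hle : P ≤ maximalIdeal B • P := fun x hx ↦ by
      obtain ⟨y, rfl⟩ := Ideal.mem_span_singleton'.mp (ht ▸ le_maximalIdeal hP.ne_top hx :)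
      have hy : y ∈ P := (hP.mem_or_mem hx).resolve_right htP
      rw [mul_comm]
      exact Submodule.smul_mem_smul (ht ▸ Ideal.mem_span_singleton_self t) hy
    rw [Submodule.eq_bot_of_le_smul_of_le_jacobson_bot _ P (IsNoetherian.noetherian P) hle
      (maximalIdeal_le_jacobson _)]
    infer_instance

section Weierstrass

variable {A B : Type*} [CommRing A] [CommRing B] {φ : A →+* B}

lemma RingHom.FaithfullyFlat.map_mem_map_iff (hff : φ.FaithfullyFlat) {I : Ideal A} {a : A} :
    φ a ∈ I.map φ ↔ a ∈ I := by
  algebraize [φ]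
  exact SetLike.ext_iff.mp (I.comap_map_eq_self_of_faithfullyFlat (B := B)) a

/-- If `H → B` is faithfully flat and `A → H → B` is Weierstrass, then so is `A → H`. -/
lemma RingHom.IsWeierstrass.of_comp_of_faithfullyFlat {A H B : Type*} [CommRing A] [CommRing H]
    [IsLocalRing H] [CommRing B] {f : A →+* H} {g : H →+* B} (h : (g.comp f).IsWeierstrass)
    (hg : g.FaithfullyFlat) : f.IsWeierstrass := by
  intro x
  obtain ⟨a, u, hau⟩ := h (g x)
  rw [RingHom.comp_apply] at hau
  have hxa : x ∈ Ideal.span {f a} := by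
    rw [← hg.map_mem_map_iff, Ideal.map_span, Set.image_singleton, Ideal.mem_span_singleton]
    exact ⟨u, hau⟩
  have hax : f a ∈ Ideal.span {x} := by
    rw [← hg.map_mem_map_iff, Ideal.map_span, Set.image_singleton, Ideal.mem_span_singleton]
    exact ⟨↑u⁻¹, by rw [hau, Units.mul_inv_cancel_right]⟩
  obtain ⟨c, hc⟩ := Ideal.mem_span_singleton.mp hxa
  obtain ⟨d, hd⟩ := Ideal.mem_span_singleton.mp hax
  have hxdc : x * (1 - d * c) = 0 := by
    rw [hd] at hc
    linear_combination hc
  rcases isUnit_or_isUnit_one_sub_self (d * c) with hu | hu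
  · exact ⟨a, (isUnit_of_mul_isUnit_right hu).unit, hc⟩
  · exact ⟨0, 1, by simpa using (hu.mul_left_eq_zero).mp hxdc⟩

variable [IsLocalRing A] [IsLocalRing B]

lemma RingHom.IsWeierstrass.map_maximalIdeal (hW : φ.IsWeierstrass) [IsLocalHom φ] :
    (maximalIdeal A).map φ = maximalIdeal B := by
  refine le_antisymm (map_maximalIdeal_le φ) fun b hb ↦ ?_
  obtain ⟨a, u, rfl⟩ := hW b
  refine Ideal.mul_mem_right _ _ (Ideal.mem_map_of_mem φ fun ha ↦ hb ?_)
  exact (ha.map φ).mul u.isUnit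

/-- If a Noetherian local ring `B` is a faithfully flat Weierstrass extension of `A` and is not a
principal ideal ring, then `A` and `B` have the same residue field. -/
lemma RingHom.IsWeierstrass.exists_sub_mem_maximalIdeal [IsNoetherianRing A] [IsNoetherianRing B]
    (hW : φ.IsWeierstrass) [IsLocalHom φ] (hff : φ.FaithfullyFlat)
    (hB : ¬ IsPrincipalIdealRing B) (b : B) : ∃ a, b - φ a ∈ maximalIdeal B := by
  have hmap := hW.map_maximalIdeal
  have hprinc (x : A) (hx : x ∈ maximalIdeal A) :
      ¬ maximalIdeal A ≤ Ideal.span {x} ⊔ maximalIdeal A ^ 2 := by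
    intro hle
    rw [sq, ← smul_eq_mul] at hle
    have hspan : maximalIdeal A = Ideal.span {x} := le_antisymm
      (Submodule.le_of_le_smul_of_le_jacobson_bot (IsNoetherian.noetherian _)
        (maximalIdeal_le_jacobson _) hle) ((Ideal.span_singleton_le_iff_mem _).mpr hx)
    refine hB (isPrincipalIdealRing_of_isPrincipal_maximalIdeal ⟨φ x, ?_⟩)
    rw [← hmap, hspan, Ideal.map_span, Set.image_singleton]
  obtain ⟨x, hx, hx2⟩ := SetLike.not_le_iff_exists.mp (hprinc 0 (zero_mem _))
  obtain ⟨y, hy, hy2⟩ := SetLike.not_le_iff_exists.mp (hprinc x hx)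
  rw [Ideal.span_singleton_zero, bot_sup_eq] at hx2
  obtain ⟨a, u, hau⟩ := hW (φ x + b * φ y)
  have ha : a ∈ Ideal.span {x, y} := by
    rw [← hff.map_mem_map_iff, Ideal.map_span, Set.image_pair, Ideal.mem_span_pair]
    refine ⟨↑u⁻¹, ↑u⁻¹ * b, ?_⟩
    rw [mul_assoc, ← mul_add, hau, mul_comm (φ a), Units.inv_mul_cancel_left]
  obtain ⟨c, d, rfl⟩ := Ideal.mem_span_pair.mp ha
  have hsq : (maximalIdeal A ^ 2).map φ = maximalIdeal B ^ 2 := by rw [Ideal.map_pow, hmap]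
  have hrel : (φ c * u - 1) * φ x + (φ d * u - b) * φ y = 0 := by
    rw [map_add, map_mul, map_mul] at hau
    linear_combination -hau
  have hq : φ d * u - b ∈ maximalIdeal B := by
    intro hq
    refine hy2 (hff.map_mem_map_iff.mp ?_)
    rw [← Ideal.unit_mul_mem_iff_mem _ hq, eq_neg_of_add_eq_zero_right hrel, neg_mem_iff]
    exact Ideal.mul_mem_left _ _
      (Ideal.mem_map_of_mem φ (Ideal.mem_sup_left (Ideal.mem_span_singleton_self x)))
  have hp : φ c * u - 1 ∈ maximalIdeal B := by
    intro hp
    refine hx2 (hff.map_mem_map_iff.mp ?_)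
    rw [← Ideal.unit_mul_mem_iff_mem _ hp, hsq, eq_neg_of_add_eq_zero_left hrel, neg_mem_iff, sq]
    exact Ideal.mul_mem_mul hq (hmap ▸ Ideal.mem_map_of_mem φ hy)
  have hc : IsUnit c := by
    rw [← notMem_maximalIdeal]
    intro hc
    have hφc : φ c * u ∈ maximalIdeal B :=
      Ideal.mul_mem_right _ _ (hmap ▸ Ideal.mem_map_of_mem φ hc)
    exact (Ideal.ne_top_iff_one (maximalIdeal B)).mp Ideal.IsPrime.ne_top'
      (by simpa using sub_mem hφc hp)
  obtain ⟨c, rfl⟩ := hc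
  refine ⟨↑c⁻¹ * d, ?_⟩
  have hcc : φ ↑c⁻¹ * φ c = 1 := by rw [← map_mul, Units.inv_mul, map_one]
  have : b - φ (↑c⁻¹ * d) = φ ↑c⁻¹ * (φ d * (φ c * u - 1) - φ c * (φ d * u - b)) := by
    rw [map_mul]
    linear_combination (-b) * hcc
  rw [this]
  exact Ideal.mul_mem_left _ _ (sub_mem (Ideal.mul_mem_left _ _ hp) (Ideal.mul_mem_left _ _ hq))

/-- If `m_A` generates `m_B` and the residue fields agree, then `A → B` is surjective modulo
every power of `m_B`. -/
lemma exists_sub_mem_maximalIdeal_pow_s16 (hmap : (maximalIdeal A).map φ = maximalIdeal B)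
    (hres : ∀ b : B, ∃ a, b - φ a ∈ maximalIdeal B) (n : ℕ) (b : B) :
    ∃ a, b - φ a ∈ maximalIdeal B ^ n := by
  induction n generalizing b with
  | zero => exact ⟨0, by simp⟩
  | succ n ih =>
    have key : ∀ x ∈ (maximalIdeal A ^ n).map φ, ∃ a, x - φ a ∈ maximalIdeal B ^ (n + 1) := by
      intro x hx
      induction hx using Submodule.span_induction with
      | mem x hx =>
        obtain ⟨a, -, rfl⟩ := hx
        exact ⟨a, by simp⟩
      | zero => exact ⟨0, by simp⟩
      | add x y _ _ hx hy =>
        obtain ⟨a, ha⟩ := hx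
        obtain ⟨a', ha'⟩ := hy
        refine ⟨a + a', ?_⟩
        rw [map_add, add_sub_add_comm]
        exact add_mem ha ha'
      | smul c x hxm hx =>
        obtain ⟨a, ha⟩ := hx
        obtain ⟨c', hc'⟩ := hres c
        refine ⟨c' * a, ?_⟩
        have hxn : x ∈ maximalIdeal B ^ n := by
          rw [← hmap, ← Ideal.map_pow]
          exact hxm
        have : c • x - φ (c' * a) = x * (c - φ c') + φ c' * (x - φ a) := by
          rw [map_mul, smul_eq_mul]; ring
        rw [this]
        refine add_mem ?_ (Ideal.mul_mem_left _ _ ha)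
        rw [pow_succ]
        exact Ideal.mul_mem_mul hxn hc'
    obtain ⟨a, ha⟩ := ih b
    obtain ⟨a', ha'⟩ := key (b - φ a) (by rwa [Ideal.map_pow, hmap])
    exact ⟨a + a', by rwa [map_add, ← sub_sub]⟩

end Weierstrass

section Completion

variable {A B : Type*} [CommRing A] [CommRing B]

lemma AdicCompletion.factorPow_evalₐ (I : Ideal A) {m n : ℕ} (hle : m ≤ n)
    (x : AdicCompletion I A) :
    Ideal.Quotient.factorPow I hle (evalₐ I n x) = evalₐ I m x := by
  induction x using AdicCompletion.induction_on with
  | _ x =>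
    rw [evalₐ_mk, evalₐ_mk]
    exact Ideal.mk_eq_mk I hle x

/-- If `I` and `J` are ideals such that `A ⧸ I ^ n ≅ B ⧸ J ^ n` for all `n` via `φ : A → B`, then
the adic completions of `A` and `B` are isomorphic, compatibly with `φ`. -/
lemma exists_adicCompletion_bijective (φ : A →+* B) (I : Ideal A) (J : Ideal B)
    (hcomap : ∀ n a, φ a ∈ J ^ n ↔ a ∈ I ^ n) (hsurj : ∀ n b, ∃ a, b - φ a ∈ J ^ n) :
    ∃ G : AdicCompletion J B →+* AdicCompletion I A, Function.Bijective G ∧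
      ∀ a, G (algebraMap B _ (φ a)) = algebraMap A _ a := by
  let e (n : ℕ) : A ⧸ I ^ n ≃+* B ⧸ J ^ n :=
    .ofBijective (Ideal.quotientMap (J ^ n) φ fun a ha ↦ (hcomap n a).mpr ha) <| by
      constructor
      · exact Ideal.quotientMap_injective' fun a ha ↦ (hcomap n a).mp ha
      · intro b
        obtain ⟨b, rfl⟩ := Ideal.Quotient.mk_surjective b
        obtain ⟨a, ha⟩ := hsurj n b
        exact ⟨Ideal.Quotient.mk _ a, (Ideal.Quotient.eq.mpr ha).symm⟩
  have hefac {m n : ℕ} (hle : m ≤ n) (x : A ⧸ I ^ n) :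
      e m (Ideal.Quotient.factorPow I hle x) = Ideal.Quotient.factorPow J hle (e n x) := by
    obtain ⟨a, rfl⟩ := Ideal.Quotient.mk_surjective x
    rfl
  let F : AdicCompletion I A →+* AdicCompletion J B := AdicCompletion.liftRingHom J
    (fun n ↦ (e n : _ →+* _).comp (AdicCompletion.evalₐ I n : _ →+* A ⧸ I ^ n)) fun hle ↦
      RingHom.ext fun x ↦ by
        simp [← AdicCompletion.factorPow_evalₐ I hle, hefac]
  let G : AdicCompletion J B →+* AdicCompletion I A := AdicCompletion.liftRingHom I
    (fun n ↦ ((e n).symm : _ →+* _).comp (AdicCompletion.evalₐ J n : _ →+* B ⧸ J ^ n)) fun hle ↦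
      RingHom.ext fun x ↦ by
        simp [← AdicCompletion.factorPow_evalₐ J hle, RingEquiv.eq_symm_apply, hefac]
  have hF (n : ℕ) (x) : AdicCompletion.evalₐ J n (F x) = e n (AdicCompletion.evalₐ I n x) :=
    AdicCompletion.evalₐ_liftRingHom ..
  have hG (n : ℕ) (x) : AdicCompletion.evalₐ I n (G x) = (e n).symm (AdicCompletion.evalₐ J n x) :=
    AdicCompletion.evalₐ_liftRingHom ..
  refine ⟨G, Function.bijective_iff_has_inverse.mpr ⟨F, fun x ↦ ?_, fun x ↦ ?_⟩, fun a ↦ ?_⟩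
  · exact AdicCompletion.ext_evalₐ fun n ↦ by rw [hF, hG, RingEquiv.apply_symm_apply]
  · exact AdicCompletion.ext_evalₐ fun n ↦ by rw [hG, hF, RingEquiv.symm_apply_apply]
  · refine AdicCompletion.ext_evalₐ fun n ↦ ?_
    rw [hG, RingEquiv.symm_apply_eq, AlgHom.commutes, AlgHom.commutes]
    rfl

end Completion

/-- Proposition 4.1: let `A ⊆ B` be a faithfully flat Weierstrass extension of Noetherian local
rings with `B` henselian. Then the canonical map `ψ : A^h → B` from the Henselization is an
injective faithfully flat homomorphism compatible with `A → A^h → B`; if `B` is not a principal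
ideal ring, there is moreover a faithfully flat embedding `B ↪ Â` into the `m_A`-adic completion
compatible with the canonical map `A → Â`; and the Henselization map `A → A^h` is Weierstrass. -/
theorem henselization_embeds_of_weierstrass {A B Ah : Type u} [CommRing A] [CommRing B]
    [IsNoetherianRing A] [IsNoetherianRing B] [IsLocalRing A] [IsLocalRing B]
    [HenselianLocalRing B]
    (φ : A →+* B) (hφ : Function.Injective φ) (hLoc : IsLocalHom φ)
    (hff : φ.IsFaithfullyFlat) (hW : φ.IsWeierstrass)
    [CommRing Ah] [HenselianLocalRing Ah] (ι : A →+* Ah) (hH : IsHenselization ι) :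
    Function.Injective ι ∧ ι.IsFaithfullyFlat ∧
    (∃ ψ : Ah →+* B, ψ.comp ι = φ ∧ Function.Injective ψ ∧ ψ.IsFaithfullyFlat) ∧
    (¬ IsPrincipalIdealRing B →
      ∃ χ : B →+* AdicCompletion (IsLocalRing.maximalIdeal A) A,
        Function.Injective χ ∧ χ.IsFaithfullyFlat ∧
          χ.comp φ = algebraMap A (AdicCompletion (IsLocalRing.maximalIdeal A) A)) ∧
    ι.IsWeierstrass := by
  replace hff : φ.FaithfullyFlat := hff
  have hι := hH.1
  obtain ⟨ψ, ⟨hψloc, hψ⟩, -⟩ := hH.2 B φ hLoc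
  have hψff : ψ.FaithfullyFlat :=
    (hH.flat_of_comp ψ (hψ ▸ hff.flat)).faithfullyFlat_of_isLocalHom
  have hιff : ι.FaithfullyFlat :=
    (RingHom.Flat.of_comp_of_faithfullyFlat (hψ ▸ hff.flat) hψff).faithfullyFlat_of_isLocalHom
  refine ⟨hιff.injective, hιff, ⟨ψ, hψ, hψff.injective, hψff⟩, fun hB ↦ ?_,
    .of_comp_of_faithfullyFlat (hψ ▸ hW) hψff⟩
  have hmap := hW.map_maximalIdeal
  obtain ⟨G, hG, hGφ⟩ := exists_adicCompletion_bijective φ (maximalIdeal A) (maximalIdeal B)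
    (fun n a ↦ by rw [← hmap, ← Ideal.map_pow, hff.map_mem_map_iff])
    (exists_sub_mem_maximalIdeal_pow_s16 hmap (hW.exists_sub_mem_maximalIdeal hff hB))
  have hχ : (G.comp (algebraMap B (AdicCompletion (maximalIdeal B) B))).FaithfullyFlat :=
    RingHom.FaithfullyFlat.stableUnderComposition _ _
      (RingHom.faithfullyFlat_algebraMap_iff.mpr .of_flat_of_isLocalHom) (.of_bijective hG)
  exact ⟨_, hχ.injective, hχ, RingHom.ext hGφ⟩
end

section
/- Let A be a Noetherian local domain of dimension one with m_A-adic completion Â. Then the completion map A → Â is Weierstrass if and only if A is analytically unramified and unibranch, i.e. if and only if Â is a domain. -/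
/-- A local ring `R` is unibranch if `R_red` is a domain and the integral closure of `R_red` in
its field of fractions is a local ring. -/
def IsUnibranch (R : Type*) [CommRing R] : Prop :=
  IsDomain (R ⧸ nilradical R) ∧
    IsLocalRing (integralClosure (R ⧸ nilradical R) (FractionRing (R ⧸ nilradical R)))

open IsLocalRing

theorem IsPrecomplete.of_moduleFinite {R M : Type*} [CommRing R] [AddCommGroup M] [Module R M]
    (I : Ideal R) [IsPrecomplete I R] [Module.Finite R M] : IsPrecomplete I M := by
  rw [← AdicCompletion.of_surjective_iff]
  intro y
  obtain ⟨t, rfl⟩ := AdicCompletion.ofTensorProduct_surjective_of_finite I M y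
  induction t using TensorProduct.induction_on with
  | zero => exact ⟨0, by simp⟩
  | add a b ha hb =>
    obtain ⟨u, hu⟩ := ha
    obtain ⟨v, hv⟩ := hb
    exact ⟨u + v, by simp [hu, hv]⟩
  | tmul r m =>
    obtain ⟨r, rfl⟩ := AdicCompletion.of_surjective I R r
    refine ⟨r • m, ?_⟩
    rw [AdicCompletion.ofTensorProduct_tmul]
    ext n
    rw [AdicCompletion.smul_eval]
    rfl

theorem IsNoetherianRing.of_isAdicComplete_of_quotient_span {R : Type*} [CommRing R] (I : Ideal R)
    [IsAdicComplete I R] {x : R} (hx : x ∈ I) [IsNoetherianRing (R ⧸ Ideal.span {x})] :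
    IsNoetherianRing R := by
  refine .of_prime fun P hP ↦ ?_
  obtain ⟨s, hs⟩ := (P.map (Ideal.Quotient.mk (Ideal.span {x}))).fg_of_isNoetherianRing
  have hsP : (s : Set (R ⧸ Ideal.span {x})) ⊆ Ideal.Quotient.mk (Ideal.span {x}) '' P := by
    intro y hy
    have : y ∈ P.map (Ideal.Quotient.mk (Ideal.span {x})) := hs ▸ Ideal.subset_span hy
    rwa [Ideal.mem_map_iff_of_surjective _ Ideal.Quotient.mk_surjective] at this
  classical
  obtain ⟨t, htP, rfl⟩ := Finset.subset_set_image_iff.mp hsP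
  have hle : Ideal.span (t : Set R) ≤ P := Ideal.span_le.mpr htP
  have hmod : ∀ p ∈ P, ∃ q ∈ Ideal.span (t : Set R), ∃ r, q - p = x * r := by
    intro p hp
    have : Ideal.Quotient.mk (Ideal.span {x}) p ∈ (Ideal.span (t : Set R)).map
        (Ideal.Quotient.mk (Ideal.span {x})) := by
      rw [Ideal.map_span, ← Finset.coe_image]
      exact hs ▸ Ideal.mem_map_of_mem _ hp
    obtain ⟨q, hq, hqp⟩ :=
      (Ideal.mem_map_iff_of_surjective _ Ideal.Quotient.mk_surjective).mp this
    exact ⟨q, hq, Ideal.mem_span_singleton.mp (Ideal.Quotient.eq.mp hqp)⟩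
  by_cases hxP : x ∈ P
  · refine ⟨insert x t, le_antisymm (Ideal.span_le.mpr ?_) fun p hp ↦ ?_⟩
    · simpa [Set.insert_subset_iff] using ⟨hxP, htP⟩
    · obtain ⟨q, hq, r, hr⟩ := hmod p hp
      rw [show p = q - r * x by linear_combination -hr]
      exact Ideal.sub_mem _ (Ideal.span_mono (by simp) hq)
        (Ideal.mul_mem_left _ _ (Ideal.subset_span (by simp)))
  suffices Function.Surjective (Submodule.inclusion hle) by
    refine ⟨t, le_antisymm hle fun p hp ↦ ?_⟩
    obtain ⟨q, hq⟩ := this ⟨p, hp⟩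
    rw [← show (q : R) = p from congrArg Subtype.val hq]
    exact q.2
  have : Module.Finite R (Ideal.span (t : Set R)) := Module.Finite.span_finset R t
  have := IsPrecomplete.of_moduleFinite (M := Ideal.span (t : Set R)) I
  have : IsHausdorff I P := by
    refine ⟨fun p hp ↦ Subtype.ext <| IsHausdorff.haus (I := I) inferInstance _ fun n ↦ ?_⟩
    rw [SModEq.zero]
    have := Submodule.mem_map_of_mem (f := P.subtype) (SModEq.zero.mp (hp n))
    rw [Submodule.map_smul''] at this
    exact Submodule.smul_mono le_rfl le_top this
  refine surjective_of_mkQ_comp_surjective (I := I) fun y ↦ ?_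
  obtain ⟨⟨p, hp⟩, rfl⟩ := Submodule.mkQ_surjective _ y
  obtain ⟨q, hq, r, hr⟩ := hmod p hp
  have hrP : r ∈ P := (hP.mem_or_mem (hr ▸ P.sub_mem (hle hq) hp)).resolve_left hxP
  refine ⟨⟨q, hq⟩, (Submodule.Quotient.eq _).mpr ?_⟩
  convert Submodule.smul_mem_smul hx (Submodule.mem_top (x := (⟨r, hrP⟩ : P))) using 1
  exact Subtype.ext hr

theorem AdicCompletion.exists_sub_algebraMap_mem {A : Type*} [CommRing A] {I : Ideal A} (hI : I.FG)
    (n : ℕ) (b : AdicCompletion I A) :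
    ∃ a : A, b - algebraMap A _ a ∈ (I ^ n).map (algebraMap A (AdicCompletion I A)) := by
  obtain ⟨a, ha⟩ := Ideal.Quotient.mk_surjective (b.val n)
  refine ⟨a, ?_⟩
  have : b - algebraMap A _ a ∈ (AdicCompletion.eval I A n).ker := by
    rw [LinearMap.mem_ker, map_sub, sub_eq_zero]
    exact ha.symm
  rw [← AdicCompletion.pow_smul_top_eq_ker_eval hI] at this
  simpa [Ideal.smul_top_eq_map] using this

theorem exists_maximalIdeal_pow_le_span {A : Type*} [CommRing A] [IsDomain A]
    [IsNoetherianRing A] [IsLocalRing A] (hdim : ringKrullDim A = 1) {a : A} (ha : a ≠ 0) :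
    ∃ k, maximalIdeal A ^ k ≤ Ideal.span {a} := by
  have : Ring.KrullDimLE 1 A := by
    rw [Ring.krullDimLE_iff]; simp [hdim]
  refine Ideal.exists_pow_le_of_le_radical_of_fg ?_ (maximalIdeal A).fg_of_isNoetherianRing
  rw [Ideal.radical_eq_sInf]
  refine le_sInf fun P ⟨hP, hPp⟩ ↦ ?_
  have : P ≠ ⊥ := by
    rintro rfl
    exact ha (by simpa using hP)
  exact (IsLocalRing.eq_maximalIdeal
    (Ring.krullDimLE_one_iff_of_isPrime_bot.mp ‹_› P this hPp)).ge

theorem isArtinianRing_localizationAway {R : Type*} [CommRing R] [IsNoetherianRing R]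
    [IsLocalRing R] {x : R} (hx : x ∈ maximalIdeal R) {k : ℕ}
    (hk : maximalIdeal R ^ k ≤ Ideal.span {x}) : IsArtinianRing (Localization.Away x) := by
  have hmin : maximalIdeal R ∈ (Ideal.span {x}).minimalPrimes := by
    refine ⟨⟨inferInstance, (Ideal.span_singleton_le_iff_mem _).mpr hx⟩, fun P hP _ ↦ ?_⟩
    have := hP.1
    exact this.le_of_pow_le (hk.trans hP.2)
  have hdim : Ring.KrullDimLE 1 R := by
    rw [Ring.krullDimLE_iff, ← IsLocalRing.maximalIdeal_height_eq_ringKrullDim]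
    exact_mod_cast Ideal.height_le_one_of_isPrincipal_of_mem_minimalPrimes _ _ hmin
  have : IsNoetherianRing (Localization.Away x) :=
    IsLocalization.isNoetherianRing (Submonoid.powers x) _ inferInstance
  rw [isArtinianRing_iff_krullDimLE_zero, Ring.krullDimLE_zero_iff]
  intro q hq
  obtain ⟨M, hM, hqM⟩ := q.exists_le_maximal hq.ne_top
  have hM' := (IsLocalization.isPrime_iff_isPrime_disjoint (.powers x) _ M).mp hM.isPrime
  have hq' := (IsLocalization.isPrime_iff_isPrime_disjoint (.powers x) _ q).mp hq
  have hle := Ideal.comap_mono (f := algebraMap R (Localization.Away x)) hqM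
  rcases Ring.krullDimLE_one_iff.mp hdim _ hM'.1 with h | h
  · have heq := le_antisymm hle (h.2 ⟨hq'.1, bot_le⟩ hle)
    have := congrArg (Ideal.map (algebraMap R (Localization.Away x))) heq
    rw [IsLocalization.map_under (.powers x), IsLocalization.map_under (.powers x)] at this
    rwa [this]
  · exact (Set.disjoint_left.mp hM'.2 (Submonoid.mem_powers x)
      (by rw [SetLike.mem_coe]; exact (eq_maximalIdeal h).symm ▸ hx)).elim

theorem exists_pow_mul_pow_eq {R : Type*} [CommRing R] [IsNoetherianRing R]
    [IsLocalRing R] {x : R} (hx : x ∈ maximalIdeal R) {k : ℕ}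
    (hk : maximalIdeal R ^ k ≤ Ideal.span {x}) (b : R) :
    ∃ (n m : ℕ) (y : R), x ^ m * b ^ n = b ^ (n + 1) * y := by
  have := isArtinianRing_localizationAway hx hk
  obtain ⟨n, y, hy⟩ := IsArtinian.exists_pow_succ_smul_dvd
    (algebraMap R (Localization.Away x) b) (1 : Localization.Away x)
  obtain ⟨⟨z, s⟩, hz⟩ := IsLocalization.surj (.powers x) y
  obtain ⟨i, hi⟩ := s.2
  simp only [smul_eq_mul, mul_one, Nat.succ_eq_add_one] at hy hz
  have h : algebraMap R (Localization.Away x) (b ^ (n + 1) * z) =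
      algebraMap R (Localization.Away x) (x ^ i * b ^ n) := by
    have hi : x ^ i = s := hi
    rw [map_mul, map_mul, ← hz, map_pow, map_pow _ _ n, ← hy, hi]; ring
  obtain ⟨⟨_, j, rfl⟩, hc⟩ := (IsLocalization.eq_iff_exists (.powers x) _).mp h
  exact ⟨n, j + i, x ^ j * z, by simp only at hc; linear_combination -hc⟩

theorem IsLocalRing.of_moduleFinite_of_isAdicComplete {R S : Type*} [CommRing R] [IsLocalRing R]
    [IsNoetherianRing R] [IsAdicComplete (maximalIdeal R) R] [CommRing S] [IsDomain S]
    [Algebra R S] [Module.Finite R S] : IsLocalRing S := by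
  set J := (maximalIdeal R).map (algebraMap R S)
  have : IsPrecomplete (maximalIdeal R) S := .of_moduleFinite _
  have : IsAdicComplete J S := IsAdicComplete.map_algebraMap_iff _ _ |>.mpr { }
  have : Module.Finite (R ⧸ maximalIdeal R) (S ⧸ J) := .of_restrictScalars_finite R _ _
  let := Ideal.Quotient.field (maximalIdeal R)
  have : IsArtinianRing (S ⧸ J) := .of_finite (R ⧸ maximalIdeal R) _
  have hloc := isLocalHom_of_le_jacobson_bot J (IsAdicComplete.le_jacobson_bot J)
  refine .of_isUnit_or_isUnit_one_sub_self fun s ↦ ?_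
  obtain ⟨n, y, hy⟩ := IsArtinian.exists_pow_succ_smul_dvd
    (Ideal.Quotient.mk J s) (1 : S ⧸ J)
  obtain ⟨y, rfl⟩ := Ideal.Quotient.mk_surjective y
  simp only [smul_eq_mul, mul_one, Nat.succ_eq_add_one] at hy
  have hpow (j : ℕ) : Ideal.Quotient.mk J s ^ (n + j) * Ideal.Quotient.mk J y ^ j =
      Ideal.Quotient.mk J s ^ n := by
    induction j with
    | zero => simp
    | succ j ih =>
      linear_combination ih + Ideal.Quotient.mk J s ^ j * Ideal.Quotient.mk J y ^ j * hy
  have hidem : Ideal.Quotient.mk J s ^ (n + 1) *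
      (Ideal.Quotient.mk J s * Ideal.Quotient.mk J y) ^ (n + 1) =
      Ideal.Quotient.mk J s ^ (n + 1) := by
    linear_combination Ideal.Quotient.mk J s * hpow (n + 1)
  obtain ⟨e, he, hmem⟩ := HenselianRing.is_henselian (I := J)
    (Polynomial.X ^ 2 - Polynomial.X : Polynomial S)
    (by monicity!) ((s * y) ^ (n + 1)) (by
      rw [← Ideal.Quotient.eq_zero_iff_mem]
      simp only [Polynomial.eval_sub, Polynomial.eval_pow, Polynomial.eval_X, map_sub, map_pow,
        map_mul]
      linear_combination Ideal.Quotient.mk J y ^ (n + 1) * hidem) (by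
      refine .of_mul_eq_one (Ideal.Quotient.mk J (2 * (s * y) ^ (n + 1) - 1)) ?_
      simp only [Polynomial.derivative_X_pow, Polynomial.derivative_X,
        Polynomial.eval_sub, Polynomial.eval_mul, Polynomial.eval_ofNat, Polynomial.eval_pow,
        Polynomial.eval_X, Polynomial.eval_one, map_sub, map_mul, map_pow, map_one, map_ofNat,
        Nat.cast_ofNat]
      linear_combination 4 * Ideal.Quotient.mk J y ^ (n + 1) * hidem)
  have hmk := Ideal.Quotient.eq.mpr hmem
  simp only [map_pow, map_mul] at hmk
  rw [← hmk] at hidem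
  have he : e * (e - 1) = 0 := by
    simp [Polynomial.IsRoot] at he
    linear_combination he
  rcases mul_eq_zero.mp he with rfl | he
  · right
    refine hloc.map_nonunit _ ?_
    rw [map_sub, map_one]
    exact IsNilpotent.isUnit_one_sub ⟨n + 1, by simpa using hidem.symm⟩
  · left
    rw [sub_eq_zero.mp he, map_one] at hmk
    exact hloc.map_nonunit _ (isUnit_of_mul_isUnit_left
      (isUnit_of_mul_isUnit_left (pow_succ' (Ideal.Quotient.mk J s * _) n ▸ hmk ▸ isUnit_one)))

theorem isUnit_one_sub_algebraMap_mul {R S : Type*} [CommRing R] [IsLocalRing R] [CommRing S]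
    [Algebra R S] [Algebra.IsIntegral R S] {x : R} (hx : x ∈ maximalIdeal R) (w : S) :
    IsUnit (1 - algebraMap R S x * w) := by
  by_contra h
  obtain ⟨M, hM, hmem⟩ := exists_max_ideal_of_mem_nonunits h
  have := Ideal.isMaximal_comap_of_isIntegral_of_isMaximal (R := R) M
  have hxM : algebraMap R S x ∈ M := by
    rw [← Ideal.mem_comap, eq_maximalIdeal this]
    exact hx
  refine hM.ne_top (M.eq_top_iff_one.mpr ?_)
  simpa using M.add_mem hmem (M.mul_mem_right w hxM)

theorem IsIntegral.of_algebraMap_of_faithfullyFlat {A R K Q : Type*} [CommRing A] [IsDomain A]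
    [CommRing R] [Algebra A R] [Module.FaithfullyFlat A R] [Field K] [Algebra A K]
    [IsFractionRing A K] [CommRing Q] [Algebra A Q] [Algebra R Q] [Algebra K Q]
    [IsScalarTower A R Q] [IsScalarTower A K Q] [FaithfulSMul R Q] {y : K}
    (hy : IsIntegral R (algebraMap K Q y)) : IsIntegral A y := by
  obtain ⟨c, d, hd, rfl⟩ := IsFractionRing.div_surjective (A := A) y
  obtain ⟨p, hp, hpy⟩ := hy
  have hd0 : algebraMap A K d ≠ 0 :=
    IsFractionRing.to_map_ne_zero_of_mem_nonZeroDivisors hd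
  set n := p.natDegree
  set y := algebraMap A K c / algebraMap A K d
  have hmul (i : ℕ) (hi : i ≤ n) :
      algebraMap A K d ^ n * y ^ i = algebraMap A K (c ^ i * d ^ (n - i)) := by
    obtain ⟨j, hj⟩ := Nat.exists_eq_add_of_le hi
    rw [hj, Nat.add_sub_cancel_left, map_mul, map_pow, map_pow, div_pow, pow_add]
    field_simp
  have hmulQ (i : ℕ) (hi : i ≤ n) :
      algebraMap A Q d ^ n * algebraMap K Q y ^ i = algebraMap A Q (c ^ i * d ^ (n - i)) := by
    rw [IsScalarTower.algebraMap_apply A K Q d, IsScalarTower.algebraMap_apply A K Q (_ * _),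
      ← map_pow (algebraMap K Q), ← map_pow (algebraMap K Q), ← map_mul, hmul i hi]
  let v : Fin n → A := fun i ↦ c ^ (i : ℕ) * d ^ (n - i)
  have hmem : algebraMap A R (c ^ n) ∈ (Ideal.span (Set.range v)).map (algebraMap A R) := by
    have hsum : algebraMap A R (c ^ n) = - ∑ i : Fin n, p.coeff i * algebraMap A R (v i) := by
      apply FaithfulSMul.algebraMap_injective R Q
      rw [← sub_eq_zero, ← mul_zero (algebraMap A Q d ^ n), ← hpy, Polynomial.eval₂_eq_sum_range,
        Finset.sum_range_succ, ← Fin.sum_univ_eq_sum_range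
          (fun i ↦ algebraMap R Q (p.coeff i) *
            algebraMap K Q y ^ i), mul_add, Finset.mul_sum,
        hp.coeff_natDegree, map_one, one_mul, hmulQ n le_rfl]
      simp only [mul_left_comm (algebraMap A Q d ^ n), hmulQ _ (Fin.is_lt _).le, map_neg, map_sum,
        map_mul (algebraMap R Q), ← IsScalarTower.algebraMap_apply A R Q, v]
      simp
      ring
    rw [hsum]
    exact neg_mem (Ideal.sum_mem _ fun i _ ↦ Ideal.mul_mem_left _ _
      (Ideal.mem_map_of_mem _ (Ideal.subset_span ⟨i, rfl⟩)))
  rw [← Ideal.mem_comap, Ideal.comap_map_eq_self_of_faithfullyFlat,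
    Ideal.mem_span_range_iff_exists_fun] at hmem
  obtain ⟨f, hf⟩ := hmem
  refine ⟨Polynomial.X ^ n - ∑ i : Fin n, Polynomial.C (f i) * Polynomial.X ^ (i : ℕ),
    Polynomial.monic_X_pow_sub (Polynomial.degree_sum_fin_lt f), ?_⟩
  rw [← mul_eq_zero_iff_left (pow_ne_zero n hd0)]
  simp only [Polynomial.eval₂_sub, Polynomial.eval₂_finsetSum, Polynomial.eval₂_mul,
    Polynomial.eval₂_C, Polynomial.eval₂_pow, Polynomial.eval₂_X, mul_sub, Finset.mul_sum,
    mul_left_comm (algebraMap A K d ^ n), hmul _ (Fin.is_lt _).le, hmul n le_rfl]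
  rw [Nat.sub_self, pow_zero, mul_one, ← hf]
  simp [v]

theorem algebraMapSubmonoid_nonZeroDivisors_le_of_flat (A R : Type*) [CommRing A] [CommRing R]
    [Algebra A R] [Module.Flat A R] :
    Algebra.algebraMapSubmonoid R (nonZeroDivisors A) ≤ nonZeroDivisors R := by
  rintro _ ⟨a, ha, rfl⟩
  have h : IsSMulRegular A a := (isRegular_iff_mem_nonZeroDivisors.mpr ha).left
  have h : IsLeftRegular (algebraMap A R a) := h.of_flat
  exact isRegular_iff_mem_nonZeroDivisors.mp (isLeftRegular_iff_isRegular.mp h)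

/-- The localization of an `A`-algebra `R` at the nonzero elements of `A`. -/
abbrev GenericFiber (A R : Type*) [CommRing A] [CommRing R] [Algebra A R] : Type _ :=
  Localization (Algebra.algebraMapSubmonoid R (nonZeroDivisors A))

namespace GenericFiber

variable (A R K : Type*) [CommRing A] [CommRing R] [Algebra A R] [Field K]
  [Algebra A K] [IsFractionRing A K]

/-- The generic fiber of an `A`-algebra is an algebra over the fraction field of `A`. -/
noncomputable abbrev algebra : Algebra K (GenericFiber A R) :=
  localizationAlgebra (nonZeroDivisors A) R

theorem isScalarTower :
    letI := algebra A R K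
    IsScalarTower A K (GenericFiber A R) :=
  letI := algebra A R K
  .of_algebraMap_eq' <| by
    rw [IsScalarTower.algebraMap_eq A R (GenericFiber A R)]
    exact (IsLocalization.map_comp _).symm

theorem faithfulSMul [Module.Flat A R] : FaithfulSMul R (GenericFiber A R) :=
  (faithfulSMul_iff_algebraMap_injective _ _).mpr <|
    IsLocalization.injective _ (algebraMapSubmonoid_nonZeroDivisors_le_of_flat A R)

theorem isDomain [Module.Flat A R] [IsDomain R] : IsDomain (GenericFiber A R) :=
  IsLocalization.isDomain_localization (algebraMapSubmonoid_nonZeroDivisors_le_of_flat A R)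

end GenericFiber

theorem isLocalRing_integralClosure_of_faithfullyFlat (A R K : Type*) [CommRing A] [IsDomain A]
    [CommRing R] [IsDomain R] [IsNoetherianRing R] [IsLocalRing R]
    [IsAdicComplete (maximalIdeal R) R] [Algebra A R] [Module.FaithfullyFlat A R] [Field K]
    [Algebra A K] [IsFractionRing A K] : IsLocalRing (integralClosure A K) := by
  let := GenericFiber.algebra A R K
  have := GenericFiber.isScalarTower A R K
  have := GenericFiber.faithfulSMul A R
  have := GenericFiber.isDomain A R
  have key (y : integralClosure A K) (S : Subalgebra R (GenericFiber A R)) [Module.Finite R S]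
      (hy : algebraMap K (GenericFiber A R) y ∈ S) (hu : IsUnit (⟨_, hy⟩ : S)) : IsUnit y := by
    obtain ⟨⟨z, hzS⟩, hz⟩ := hu.exists_right_inv
    have hz : algebraMap K (GenericFiber A R) y * z = 1 := congrArg Subtype.val hz
    have hy0 : (y : K) ≠ 0 := by
      intro h
      simp [h] at hz
    have hinv : algebraMap K (GenericFiber A R) (y : K)⁻¹ = z := by
      rw [← mul_one (algebraMap K _ _), ← hz, ← mul_assoc, ← map_mul, inv_mul_cancel₀ hy0,
        map_one, one_mul]
    have hint : IsIntegral A (y : K)⁻¹ :=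
      .of_algebraMap_of_faithfullyFlat (R := R) (Q := GenericFiber A R) <| by
        rw [hinv]
        exact (Algebra.IsIntegral.isIntegral (R := R) (⟨z, hzS⟩ : S)).map S.val
    exact .of_mul_eq_one ⟨_, hint⟩ (Subtype.ext (mul_inv_cancel₀ hy0))
  refine .of_isUnit_or_isUnit_one_sub_self fun y ↦ ?_
  have hy : IsIntegral R (algebraMap K (GenericFiber A R) y) :=
    (y.2.map (IsScalarTower.toAlgHom A K (GenericFiber A R))).tower_top
  let S := Algebra.adjoin R {algebraMap K (GenericFiber A R) y}
  have : Module.Finite R S := Algebra.finite_adjoin_simple_of_isIntegral hy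
  have hyS : algebraMap K (GenericFiber A R) y ∈ S := Algebra.self_mem_adjoin_singleton _ _
  have hyS' : algebraMap K (GenericFiber A R) (1 - y : integralClosure A K) ∈ S := by
    simpa using S.sub_mem S.one_mem hyS
  have : IsLocalRing S := .of_moduleFinite_of_isAdicComplete (R := R)
  rcases isUnit_or_isUnit_one_sub_self (⟨_, hyS⟩ : S) with h | h
  · exact .inl (key y S hyS h)
  · refine .inr (key (1 - y) S hyS' ?_)
    convert h using 1
    exact Subtype.ext (by simp)

theorem isDomain_of_isLocalRing_integralClosure {A R : Type*} (K : Type*) [CommRing A] [IsDomain A]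
    [CommRing R] [IsReduced R] [IsLocalRing R] [Algebra A R] [Module.FaithfullyFlat A R] [Field K]
    [Algebra A K] [IsFractionRing A K] [IsLocalRing (integralClosure A K)] {x : A} (hx0 : x ≠ 0)
    (hx : algebraMap A R x ∈ maximalIdeal R)
    (hdense : ∀ (n : ℕ) (b : R), ∃ (a : A) (z : R), b = algebraMap A R a + algebraMap A R x ^ n * z)
    (hreg : ∀ b : R, ∃ (n m : ℕ) (y : R), algebraMap A R x ^ m * b ^ n = b ^ (n + 1) * y) :
    IsDomain R := by
  let := GenericFiber.algebra A R K
  have := GenericFiber.isScalarTower A R K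
  have := GenericFiber.faithfulSMul A R
  set Q := GenericFiber A R
  have hinj := FaithfulSMul.algebraMap_injective R Q
  have hxreg (n : ℕ) (b : R) (h : b * algebraMap A R x ^ n = 0) : b = 0 :=
    mem_nonZeroDivisors_iff_right.mp (pow_mem (algebraMapSubmonoid_nonZeroDivisors_le_of_flat A R
      ⟨x, mem_nonZeroDivisors_of_ne_zero hx0, rfl⟩) n) b h
  suffices NoZeroDivisors R from NoZeroDivisors.to_isDomain R
  refine ⟨fun {b b'} hbb' ↦ ?_⟩
  obtain ⟨n, k, w, hw⟩ := hreg b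
  have hbw : b * (algebraMap A R x ^ k - b * w) = 0 := by
    refine IsReduced.eq_zero _ ⟨n + 1, ?_⟩
    rw [mul_pow, pow_succ' (_ - _)]
    linear_combination b * (algebraMap A R x ^ k - b * w) ^ n * hw
  obtain ⟨a, z, haz⟩ := hdense (k + 1) (b * w)
  have hx0K : algebraMap A K x ≠ 0 := by simpa using hx0
  set X : Q := algebraMap R Q (algebraMap A R x)
  have hX : algebraMap K Q (algebraMap A K x) = X := by
    rw [← IsScalarTower.algebraMap_apply A K Q, IsScalarTower.algebraMap_apply A R Q]
  set Y : Q := algebraMap K Q (algebraMap A K x)⁻¹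
  have hXY : X * Y = 1 := by rw [← hX, ← map_mul, mul_inv_cancel₀ hx0K, map_one]
  have hXYk : X ^ k * Y ^ k = 1 := by rw [← mul_pow, hXY, one_pow]
  set e : Q := algebraMap R Q (b * w) * Y ^ k
  have he : e * e = e := by
    have := congrArg (algebraMap R Q) hbw
    simp only [map_mul, map_sub, map_pow, map_zero] at this
    simp only [e, map_mul]
    linear_combination -Y ^ (2 * k) * algebraMap R Q w * this +
      algebraMap R Q b * algebraMap R Q w * Y ^ k * hXYk
  have heint : IsIntegral R e :=
    ⟨Polynomial.X ^ 2 - Polynomial.X, by monicity!, by simp [sq, he]⟩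
  let y : K := algebraMap A K a * (algebraMap A K x)⁻¹ ^ k
  have hye : algebraMap K Q y = e - X * algebraMap R Q z := by
    simp only [e, haz, y, map_mul, map_add, map_pow, ← IsScalarTower.algebraMap_apply A K Q,
      ← IsScalarTower.algebraMap_apply A R Q a]
    linear_combination -X * algebraMap R Q z * hXYk
  have hyint : IsIntegral A y := .of_algebraMap_of_faithfullyFlat (R := R) (Q := Q) <| by
    rw [hye]
    exact heint.sub (isIntegral_algebraMap.mul isIntegral_algebraMap)
  have hunit (f v : Q) (r : R) (hv : IsIntegral R v)
      (h : f * (1 - X * (algebraMap R Q r * v)) = 0) : f = 0 := by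
    have := (isUnit_one_sub_algebraMap_mul (S := integralClosure R Q) hx
      ⟨algebraMap R Q r * v, isIntegral_algebraMap.mul hv⟩).map (integralClosure R Q).val
    exact this.mul_left_eq_zero.mp h
  have hinv (u : integralClosure A K) (hu : IsUnit u) :
      ∃ v : Q, IsIntegral R v ∧ algebraMap K Q u * v = 1 := by
    obtain ⟨v, hv⟩ := hu.exists_right_inv
    refine ⟨algebraMap K Q v, (v.2.map (IsScalarTower.toAlgHom A K Q)).tower_top, ?_⟩
    rw [← map_mul, show (u * v : K) = 1 from congrArg Subtype.val hv, map_one]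
  rcases isUnit_or_isUnit_one_sub_self (⟨y, hyint⟩ : integralClosure A K) with h | h
  · obtain ⟨v, hv, hyv⟩ := hinv _ h
    right
    have hyv : (e - X * algebraMap R Q z) * v = 1 := by rw [← hye]; exact hyv
    have h1 : 1 - e = 0 := hunit _ v (-z) hv <| by
      rw [map_neg]
      linear_combination (e - 1) * hyv - v * he
    refine hxreg k _ (hinj ?_)
    have h0 := congrArg (algebraMap R Q) hbb'
    simp only [e, map_mul, map_zero, map_pow] at h1 h0 ⊢
    linear_combination algebraMap R Q b' * X ^ k * h1 + algebraMap R Q w * X ^ k * Y ^ k * h0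
  · obtain ⟨v, hv, hyv⟩ := hinv _ h
    left
    have hyv : (1 - (e - X * algebraMap R Q z)) * v = 1 := by
      rw [← hye, ← map_one (algebraMap K Q), ← map_sub, map_one]; exact hyv
    have h1 : e = 0 := hunit _ v z hv <| by
      linear_combination -e * hyv - v * he
    refine hxreg k _ (hinj ?_)
    have h0 := congrArg (algebraMap R Q) hbw
    simp only [e, map_mul, map_zero, map_pow, map_sub] at h1 h0 ⊢
    linear_combination h0 + algebraMap R Q b * X ^ k * h1 -
      algebraMap R Q b * algebraMap R Q b * algebraMap R Q w * hXYk

theorem isUnibranch_iff_isLocalRing_integralClosure (A : Type*) [CommRing A] [IsDomain A] :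
    IsUnibranch A ↔ IsLocalRing (integralClosure A (FractionRing (A ⧸ nilradical A))) := by
  let B := A ⧸ nilradical A
  have : (nilradical A).IsPrime := by
    rw [nilradical_eq_bot_iff.mpr inferInstance]
    exact Ideal.isPrime_bot
  have hB : IsDomain B := Ideal.Quotient.isDomain _
  have : Algebra.IsIntegral A B := inferInstance
  have heq : (integralClosure B (FractionRing B)).restrictScalars A =
      integralClosure A (FractionRing B) := by
    ext y
    exact ⟨fun h ↦ isIntegral_trans y h, fun h ↦ h.tower_top⟩
  rw [IsUnibranch, and_iff_right hB, ← heq]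
  rfl

theorem isFractionRing_quotient_nilradical (A : Type*) [CommRing A] [IsDomain A] :
    IsFractionRing A (FractionRing (A ⧸ nilradical A)) :=
  .of_ringEquiv_left (RingEquiv.ofBijective (Ideal.Quotient.mk (nilradical A))
    ⟨(RingHom.injective_iff_ker_eq_bot _).mpr (by simp [Ideal.mk_ker]),
      Ideal.Quotient.mk_surjective⟩) fun _ ↦ rfl

theorem AdicCompletion.isDomain_of_isWeierstrass {A : Type*} [CommRing A] [IsDomain A]
    [IsNoetherianRing A] [IsLocalRing A]
    (h : (algebraMap A (AdicCompletion (maximalIdeal A) A)).IsWeierstrass) :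
    IsDomain (AdicCompletion (maximalIdeal A) A) := by
  suffices NoZeroDivisors (AdicCompletion (maximalIdeal A) A) from NoZeroDivisors.to_isDomain _
  refine ⟨fun {b c} hbc ↦ or_iff_not_imp_left.mpr fun hb ↦ ?_⟩
  obtain ⟨a, u, rfl⟩ := h b
  have ha : a ≠ 0 := by
    rintro rfl
    simp at hb
  have hreg := algebraMapSubmonoid_nonZeroDivisors_le_of_flat A (AdicCompletion (maximalIdeal A) A)
    ⟨a, mem_nonZeroDivisors_of_ne_zero ha, rfl⟩
  exact (Units.mul_right_eq_zero u).mp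
    ((mul_left_mem_nonZeroDivisors_eq_zero_iff hreg).mp (by rw [← mul_assoc, hbc]))

theorem RingHom.IsWeierstrass.of_isDomain {A R : Type*} [CommRing A] [CommRing R]
    [IsDomain R] [IsLocalRing R] [Algebra A R] {x : A}
    (hx : algebraMap A R x ∈ maximalIdeal R)
    (hdense : ∀ (n : ℕ) (b : R), ∃ (a : A) (z : R), b = algebraMap A R a + algebraMap A R x ^ n * z)
    (hreg : ∀ b : R, ∃ (n m : ℕ) (y : R), algebraMap A R x ^ m * b ^ n = b ^ (n + 1) * y) :
    (algebraMap A R).IsWeierstrass := by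
  intro b
  by_cases hb : b = 0
  · exact ⟨0, 1, by simp [hb]⟩
  obtain ⟨n, m, y, hy⟩ := hreg b
  have hy : algebraMap A R x ^ m = b * y :=
    mul_right_cancel₀ (pow_ne_zero n hb) (by linear_combination hy)
  obtain ⟨a, z, haz⟩ := hdense (m + 1) b
  have hu : IsUnit (1 - algebraMap A R x * (y * z)) :=
    isUnit_one_sub_self_of_mem_nonunits _ (Ideal.mul_mem_right _ _ hx)
  refine ⟨a, hu.unit⁻¹, (Units.eq_mul_inv_iff_mul_eq _).mpr ?_⟩
  rw [IsUnit.unit_spec]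
  linear_combination haz + algebraMap A R x * z * hy

/-- Corollary 4.5: for a Noetherian local domain `A` of dimension one, the completion map
`A → Â` (to the `m_A`-adic completion) is Weierstrass iff `A` is analytically unramified
(`Â` is reduced) and unibranch, equivalently, iff `Â` is a domain. -/
theorem completion_isWeierstrass_iff {A : Type*} [CommRing A] [IsDomain A]
    [IsNoetherianRing A] [IsLocalRing A] (hdim : ringKrullDim A = 1) :
    ((algebraMap A
        (AdicCompletion (IsLocalRing.maximalIdeal A) A)).IsWeierstrass ↔
      (IsReduced (AdicCompletion (IsLocalRing.maximalIdeal A) A) ∧ IsUnibranch A)) ∧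
    ((algebraMap A
        (AdicCompletion (IsLocalRing.maximalIdeal A) A)).IsWeierstrass ↔
      IsDomain (AdicCompletion (IsLocalRing.maximalIdeal A) A)) := by
  set R := AdicCompletion (maximalIdeal A) A
  have hfg : (maximalIdeal A).FG := (maximalIdeal A).fg_of_isNoetherianRing
  have hbot : maximalIdeal A ≠ ⊥ := fun h ↦ by
    simp [ringKrullDim_eq_zero_of_isField (isField_iff_maximalIdeal_eq.mpr h)] at hdim
  obtain ⟨x, hxm, hx0⟩ := Submodule.exists_mem_ne_zero_of_ne_bot hbot
  have hx : algebraMap A R x ∈ maximalIdeal R := by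
    rw [AdicCompletion.maximalIdeal_eq_map]
    exact Ideal.mem_map_of_mem _ hxm
  have hdense (n : ℕ) (b : R) :
      ∃ (a : A) (z : R), b = algebraMap A R a + algebraMap A R x ^ n * z := by
    obtain ⟨k, hk⟩ := exists_maximalIdeal_pow_le_span hdim (pow_ne_zero n hx0)
    obtain ⟨a, ha⟩ := AdicCompletion.exists_sub_algebraMap_mem hfg k b
    have := Ideal.map_mono hk ha
    rw [Ideal.map_span, Set.image_singleton, map_pow, Ideal.mem_span_singleton] at this
    obtain ⟨z, hz⟩ := this
    exact ⟨a, z, by linear_combination hz⟩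
  have hnoeth : IsNoetherianRing R := by
    have hsurj : Function.Surjective
        ((Ideal.Quotient.mk (Ideal.span {algebraMap A R x})).comp (algebraMap A R)) := by
      intro y
      obtain ⟨b, rfl⟩ := Ideal.Quotient.mk_surjective y
      obtain ⟨a, z, rfl⟩ := hdense 1 b
      refine ⟨a, Ideal.Quotient.eq.mpr (Ideal.mem_span_singleton.mpr ⟨-z, by ring⟩)⟩
    have := isNoetherianRing_of_surjective _ _ _ hsurj
    exact .of_isAdicComplete_of_quotient_span (maximalIdeal R) hx
  obtain ⟨k, hk⟩ := exists_maximalIdeal_pow_le_span hdim hx0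
  have hkR : maximalIdeal R ^ k ≤ Ideal.span {algebraMap A R x} := by
    rw [AdicCompletion.maximalIdeal_eq_map, ← Ideal.map_pow, ← Set.image_singleton,
      ← Ideal.map_span]
    exact Ideal.map_mono hk
  have hreg := exists_pow_mul_pow_eq hx hkR
  have hff : Module.FaithfullyFlat A R := .of_flat_of_isLocalHom
  have := isFractionRing_quotient_nilradical A
  have : (nilradical A).IsPrime := by
    rw [nilradical_eq_bot_iff.mpr inferInstance]
    exact Ideal.isPrime_bot
  have hiff : (algebraMap A R).IsWeierstrass ↔ IsDomain R :=
    ⟨AdicCompletion.isDomain_of_isWeierstrass, fun _ ↦ .of_isDomain hx hdense hreg⟩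
  refine ⟨?_, hiff⟩
  rw [hiff, isUnibranch_iff_isLocalRing_integralClosure]
  refine ⟨fun _ ↦ ⟨inferInstance, isLocalRing_integralClosure_of_faithfullyFlat A R _⟩, ?_⟩
  rintro ⟨_, _⟩
  exact isDomain_of_isLocalRing_integralClosure (FractionRing (A ⧸ nilradical A)) hx0 hx hdense hreg
end
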